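/- arXiv:2308.01213 — 13 statements merged into one kernel-verified Lean document; each statement's English description precedes it below -/
import Mathlib

section
/- Let T > 0, let X ⊆ ℝ, let f : ℝ × [0,T] → ℝ be continuous, and for every x ∈ X let h_x : [0,T] → ℝ be differentiable with h_x'(t) = f(h_x(t), t) for all t ∈ [0,T] and h_x(0) = x. Assume uniqueness of solutions: for all x₁, x₂ ∈ X, if h_{x₁}(t₀) = h_{x₂}(t₀) for some t₀ ∈ [0,T], then x₁ = x₂. Then the time-t map is strictly monotonically increasing in the initial condition: for all x₁, x₂ ∈ X with x₁ < x₂ and all t ∈ [0,T], h_{x₁}(t) < h_{x₂}(t). -/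
/-- Strict monotonicity of the time-t map of a basic neural ODE in the initial condition,
under uniqueness of solutions. -/
theorem stmt_0 (T : ℝ) (hT : 0 < T) (X : Set ℝ) (f : ℝ → ℝ → ℝ)
    (hf : ContinuousOn (fun p : ℝ × ℝ => f p.1 p.2) (Set.univ ×ˢ Set.Icc 0 T))
    (h : ℝ → ℝ → ℝ)
    (hderiv : ∀ x ∈ X, ∀ t ∈ Set.Icc (0:ℝ) T, HasDerivAt (h x) (f (h x t) t) t)
    (hinit : ∀ x ∈ X, h x 0 = x)
    (huniq : ∀ x₁ ∈ X, ∀ x₂ ∈ X, ∀ t₀ ∈ Set.Icc (0:ℝ) T, h x₁ t₀ = h x₂ t₀ → x₁ = x₂) :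
    ∀ x₁ ∈ X, ∀ x₂ ∈ X, x₁ < x₂ → ∀ t ∈ Set.Icc (0:ℝ) T, h x₁ t < h x₂ t := by
  intro x₁ hx₁ x₂ hx₂ hlt t ht
  by_contra! hle
  have hsub : Set.Icc 0 t ⊆ Set.Icc 0 T := Set.Icc_subset_Icc_right ht.2
  have hcont : ∀ x ∈ X, ContinuousOn (h x) (Set.Icc 0 t) := fun x hx s hs =>
    (hderiv x hx s (hsub hs)).continuousAt.continuousWithinAt
  have hzero : (0 : ℝ) ∈ Set.Icc (h x₁ 0 - h x₂ 0) (h x₁ t - h x₂ t) := by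
    rw [hinit x₁ hx₁, hinit x₂ hx₂]
    constructor <;> linarith
  obtain ⟨s, hs, hs0⟩ :=
    intermediate_value_Icc ht.1 ((hcont x₁ hx₁).sub (hcont x₂ hx₂)) hzero
  exact hlt.ne (huniq x₁ hx₁ x₂ hx₂ s (hsub hs) (sub_eq_zero.mp hs0))
end

section
/- Let T > 0, let f : ℝ × [0,T] → ℝ be continuous, and for every x ∈ ℝ let h_x : [0,T] → ℝ be differentiable with h_x'(t) = f(h_x(t), t) for all t ∈ [0,T] and h_x(0) = x. Assume uniqueness of solutions: for all x₁, x₂ ∈ ℝ, if h_{x₁}(t₀) = h_{x₂}(t₀) for some t₀ ∈ [0,T], then x₁ = x₂. Then it is impossible that h_x(T) = −x for all x ∈ ℝ; that is, the map Φ(x) = −x cannot be embedded as the time-T map of a basic neural ODE. -/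
/-- The map `Φ(x) = -x` cannot be embedded as the time-T map of a basic neural ODE
with continuous vector field and unique solutions. -/
theorem stmt_1 (T : ℝ) (hT : 0 < T) (f : ℝ → ℝ → ℝ)
    (hf : ContinuousOn (fun p : ℝ × ℝ => f p.1 p.2) (Set.univ ×ˢ Set.Icc 0 T))
    (h : ℝ → ℝ → ℝ)
    (hderiv : ∀ x : ℝ, ∀ t ∈ Set.Icc (0:ℝ) T, HasDerivAt (h x) (f (h x t) t) t)
    (hinit : ∀ x : ℝ, h x 0 = x)
    (huniq : ∀ x₁ x₂ : ℝ, ∀ t₀ ∈ Set.Icc (0:ℝ) T, h x₁ t₀ = h x₂ t₀ → x₁ = x₂) :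
    ¬ ∀ x : ℝ, h x T = -x := by
  intro hneg
  have hcont : ContinuousOn (fun t => h 1 t - h 0 t) (Set.Icc 0 T) := fun t ht =>
    ((hderiv 1 t ht).continuousAt.sub (hderiv 0 t ht).continuousAt).continuousWithinAt
  obtain ⟨t, ht, hzero⟩ : (0 : ℝ) ∈ (fun t => h 1 t - h 0 t) '' Set.Icc 0 T :=
    intermediate_value_Icc' hT.le hcont (by simp [hneg, hinit])
  exact one_ne_zero (huniq 1 0 t ht (sub_eq_zero.mp hzero))
end

section
/- Let φ : ℝⁿ × ℝ → ℝⁿ be a flow, i.e. φ(x,0) = x and φ(x, s+t) = φ(φ(x,s), t) for all x ∈ ℝⁿ and s, t ∈ ℝ, such that for each x the trajectory t ↦ φ(x,t) is continuous. Let T > 0, let Z ⊆ X ⊆ ℝⁿ, and let C₁, …, C_m be pairwise disjoint subsets of ℝⁿ with the separation property that every continuous path γ : [0,1] → ℝⁿ with γ(0) ∈ C_i and γ(1) ∈ C_j for i ≠ j meets Z. Let Φ : X → ℝⁿ be a map with Φ(z) = z for all z ∈ Z, and suppose there exists x* ∈ X ∩ C_{i*} with Φ(x*) ∈ C_{j*}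 for some i* ≠ j*. Then it is impossible that φ(x, T) = Φ(x) for all x ∈ X; that is, Φ cannot be embedded as the time-T map of the flow φ. -/
/-- A map which is the identity on a separating set `Z` but moves some point from one
component `C i₀` to another `C j₀` cannot be embedded as the time-T map of a flow. -/
theorem stmt_2 (n : ℕ) (φ : (Fin n → ℝ) → ℝ → (Fin n → ℝ))
    (hflow0 : ∀ x, φ x 0 = x)
    (hflow : ∀ x s t, φ x (s + t) = φ (φ x s) t)
    (hcont : ∀ x, Continuous (φ x))
    (T : ℝ) (hT : 0 < T)
    (m : ℕ) (C : Fin m → Set (Fin n → ℝ))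
    (hC : ∀ i j : Fin m, i ≠ j → Disjoint (C i) (C j))
    (Z X : Set (Fin n → ℝ)) (hZX : Z ⊆ X)
    (hsep : ∀ γ : ℝ → (Fin n → ℝ), ContinuousOn γ (Set.Icc 0 1) →
      ∀ i j : Fin m, i ≠ j → γ 0 ∈ C i → γ 1 ∈ C j → ∃ t ∈ Set.Icc (0:ℝ) 1, γ t ∈ Z)
    (Φ : (Fin n → ℝ) → (Fin n → ℝ))
    (hid : ∀ z ∈ Z, Φ z = z)
    (x₀ : Fin n → ℝ) (i₀ j₀ : Fin m) (hij : i₀ ≠ j₀)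
    (hx₀ : x₀ ∈ X ∩ C i₀) (hΦx₀ : Φ x₀ ∈ C j₀) :
    ¬ ∀ x ∈ X, φ x T = Φ x := by
  intro hemb
  obtain ⟨hxX, hxC⟩ := hx₀
  have hend : φ x₀ T = Φ x₀ := hemb x₀ hxX
  obtain ⟨t, -, hz⟩ := hsep (fun t => φ x₀ (t * T))
    ((hcont x₀).comp (continuous_id.mul continuous_const)).continuousOn i₀ j₀ hij
    (by simpa [hflow0] using hxC) (by simpa [hend] using hΦx₀)
  have hfix : φ (φ x₀ (t * T)) T = φ x₀ (t * T) := (hemb _ (hZX hz)).trans (hid _ hz)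
  have hper : φ x₀ T = x₀ := calc
    φ x₀ T = φ x₀ (t * T + T + -(t * T)) := by congr 1; ring
    _ = φ (φ x₀ (t * T)) (-(t * T)) := by rw [hflow, hflow, hfix]
    _ = x₀ := by rw [← hflow, add_neg_cancel, hflow0]
  rw [← hend, hper] at hΦx₀
  exact Set.disjoint_left.mp (hC i₀ j₀ hij) hxC hΦx₀
end

section
/- Let T > 0 and c ∈ ℝ. (i) If c > 0, then for every x ∈ ℝ the function h_x(t) = x·exp((ln c)·t/T) satisfies h_x'(t) = (ln(c)/T)·h_x(t) for all t, h_x(0) = x, and h_x(T) = c·x; hence the map Φ(x) = cx is the time-T map of the basic neural ODE with vector field f(h) = (ln(c)/T)·h. (ii) If c ≤ 0, then for any continuous f : ℝ × [0,T] → ℝ and any family of differentiable solutions h_x : [0,T] → ℝ with h_x'(t) = f(h_x(t), t), h_x(0) = x, satisfying the uniqueness property that h_{x₁}(t₀) = h_{x₂}(t₀) for some t₀ ∈ [0,T] implies x₁ = x₂, it is impossible that h_x(T) = c·x for all x ∈ ℝ. -/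
/-- The linear map `Φ(x) = c·x` is the time-T map of the basic neural ODE with vector
field `f(h) = (ln c / T)·h` when `c > 0`, and cannot be embedded as the time-T map of
any basic neural ODE (continuous vector field, unique solutions) when `c ≤ 0`. -/
theorem stmt_6 (T : ℝ) (hT : 0 < T) (c : ℝ) :
    (0 < c → ∀ x : ℝ,
      (∀ t : ℝ, HasDerivAt (fun s => x * Real.exp (Real.log c * s / T))
        (Real.log c / T * (x * Real.exp (Real.log c * t / T))) t)
      ∧ x * Real.exp (Real.log c * 0 / T) = x
      ∧ x * Real.exp (Real.log c * T / T) = c * x)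
    ∧ (c ≤ 0 → ∀ (f : ℝ → ℝ → ℝ) (h : ℝ → ℝ → ℝ),
        ContinuousOn (fun p : ℝ × ℝ => f p.1 p.2) (Set.univ ×ˢ Set.Icc 0 T) →
        (∀ x : ℝ, ∀ t ∈ Set.Icc (0:ℝ) T, HasDerivAt (h x) (f (h x t) t) t) →
        (∀ x : ℝ, h x 0 = x) →
        (∀ x₁ x₂ : ℝ, ∀ t₀ ∈ Set.Icc (0:ℝ) T, h x₁ t₀ = h x₂ t₀ → x₁ = x₂) →
        ¬ ∀ x : ℝ, h x T = c * x) := by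
  refine ⟨fun hc x => ⟨fun t => ?_, by simp, ?_⟩, ?_⟩
  · have hlin : HasDerivAt (fun s : ℝ => Real.log c * s / T) (Real.log c / T) t := by
      simpa using ((hasDerivAt_id t).const_mul (Real.log c)).div_const T
    exact (hlin.exp.const_mul x).congr_deriv (by ring)
  · rw [mul_div_cancel_right₀ _ hT.ne', Real.exp_log hc, mul_comm]
  · intro hc f h _ hderiv hinit huniq hT_map
    -- The solutions from `0` and `1` swap order (weakly), so they meet by the IVT.
    have hcont (x : ℝ) : ContinuousOn (h x) (Set.Icc 0 T) := fun t ht =>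
      (hderiv x t ht).continuousAt.continuousWithinAt
    obtain ⟨t₀, ht₀, hmeet⟩ := intermediate_value_Icc' hT.le ((hcont 1).sub (hcont 0))
      (show (0 : ℝ) ∈ Set.Icc _ _ by simp [hinit, hT_map, hc])
    exact one_ne_zero (huniq 1 0 t₀ ht₀ (sub_eq_zero.mp hmeet))
end

section
/- Let c > 0 and α > 0 with α ≠ 1, and consider the map Φ(x) = c·x^α on x > 0. For every a ∈ ℝ, the function f_a : (0,∞) → ℝ defined by f_a(x) = a·x·ln(c^{1/(α−1)}·x) satisfies Julia's functional equation for Φ: for all x > 0, c·α·x^{α−1}·f_a(x) = f_a(c·x^α). -/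
/-- For `Φ(x) = c·x^α` (with `c > 0`, `α > 0`, `α ≠ 1`), the family
`f_a(x) = a·x·ln(c^{1/(α-1)}·x)` solves Julia's functional equation
`c·α·x^{α-1}·f_a(x) = f_a(c·x^α)` on `x > 0`. -/
theorem stmt_7 (c α : ℝ) (hc : 0 < c) (hα : 0 < α) (hα1 : α ≠ 1) (a : ℝ) :
    ∀ x : ℝ, 0 < x →
      c * α * x ^ (α - 1) * (a * x * Real.log (c ^ ((1:ℝ) / (α - 1)) * x))
        = a * (c * x ^ α) * Real.log (c ^ ((1:ℝ) / (α - 1)) * (c * x ^ α)) := by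
  intro x hx
  have hα0 : α - 1 ≠ 0 := sub_ne_zero.mpr hα1
  have hcp : c ^ ((1:ℝ) / (α - 1)) ≠ 0 := (Real.rpow_pos_of_pos hc _).ne'
  have hxα : x ^ α ≠ 0 := (Real.rpow_pos_of_pos hx _).ne'
  have hlog : Real.log (c ^ ((1:ℝ) / (α - 1)) * (c * x ^ α))
      = α * Real.log (c ^ ((1:ℝ) / (α - 1)) * x) := by
    rw [Real.log_mul hcp (mul_ne_zero hc.ne' hxα), Real.log_mul hc.ne' hxα,
      Real.log_mul hcp hx.ne', Real.log_rpow hc, Real.log_rpow hx]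
    field_simp
    ring
  have hpow : x ^ (α - 1) * x = x ^ α := by
    rw [Real.rpow_sub_one hx.ne', div_mul_cancel₀ _ hx.ne']
  rw [hlog, ← hpow]
  ring
end

section
/- Let T > 0, c > 0, α > 0 with α ≠ 1, and x > 0. Define h : [0,∞) → ℝ by h(t) = c^{1/(1−α)}·(x·c^{1/(α−1)})^{α^{t/T}}, using real powers. Then h(0) = x, h(T) = c·x^α, h(t) > 0 for all t ≥ 0, and h is differentiable with h'(t) = (ln(α)/T)·h(t)·ln(c^{1/(α−1)}·h(t)) for all t ≥ 0. Hence the map Φ(x) = c·x^α on (0,∞) is embedded as the time-T map of the basic neural ODE with vector field f(h) = (ln(α)/T)·h·ln(c^{1/(α−1)}·h). -/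
/-- The explicit solution of the basic neural ODE with vector field
`f(h) = (ln α / T)·h·ln(c^{1/(α-1)}·h)` starting at `x > 0` is
`h(t) = c^{1/(1-α)}·(x·c^{1/(α-1)})^{α^{t/T}}`, which embeds `Φ(x) = c·x^α` as its
time-T map. -/
theorem stmt_8 (T c α x : ℝ) (hT : 0 < T) (hc : 0 < c) (hα : 0 < α) (hα1 : α ≠ 1)
    (hx : 0 < x) (h : ℝ → ℝ)
    (hh : ∀ t, h t = c ^ ((1:ℝ) / (1 - α)) * (x * c ^ ((1:ℝ) / (α - 1))) ^ (α ^ (t / T))) :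
    h 0 = x ∧ h T = c * x ^ α ∧
      ∀ t : ℝ, 0 ≤ t → 0 < h t ∧
        HasDerivAt h (Real.log α / T * h t * Real.log (c ^ ((1:ℝ) / (α - 1)) * h t)) t := by
  have h1 : α - 1 ≠ 0 := sub_ne_zero.mpr hα1
  have hexp : (1:ℝ) / (1 - α) = -(1 / (α - 1)) := by
    rw [← neg_sub α 1, div_neg]
  have hinv : c ^ ((1:ℝ) / (1 - α)) * c ^ ((1:ℝ) / (α - 1)) = 1 := by
    rw [← Real.rpow_add hc, hexp, neg_add_cancel, Real.rpow_zero]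
  have hK : 0 < c ^ ((1:ℝ) / (1 - α)) := Real.rpow_pos_of_pos hc _
  have hD : 0 < c ^ ((1:ℝ) / (α - 1)) := Real.rpow_pos_of_pos hc _
  have hB : 0 < x * c ^ ((1:ℝ) / (α - 1)) := mul_pos hx hD
  refine ⟨?_, ?_, fun t _ => ⟨?_, ?_⟩⟩
  · rw [hh, zero_div, Real.rpow_zero, Real.rpow_one]
    linear_combination x * hinv
  · have hpow : c ^ ((1:ℝ) / (1 - α)) * c ^ ((1:ℝ) / (α - 1) * α) = c := by
      have he : -(1 / (α - 1)) + 1 / (α - 1) * α = 1 := by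
        field_simp
        ring
      rw [← Real.rpow_add hc, hexp, he, Real.rpow_one]
    rw [hh, div_self hT.ne', Real.rpow_one, Real.mul_rpow hx.le hD.le, ← Real.rpow_mul hc.le]
    linear_combination x ^ α * hpow
  · rw [hh]
    exact mul_pos hK (Real.rpow_pos_of_pos hB _)
  · have hlog : Real.log (c ^ ((1:ℝ) / (α - 1)) * h t)
        = α ^ (t / T) * Real.log (x * c ^ ((1:ℝ) / (α - 1))) := by
      rw [hh, ← mul_assoc, mul_comm (c ^ ((1:ℝ) / (α - 1))) (c ^ ((1:ℝ) / (1 - α))), hinv,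
        one_mul, Real.log_rpow hB]
    have hderiv := ((((hasDerivAt_id t).div_const T).const_rpow hα).const_rpow hB).const_mul
      (c ^ ((1:ℝ) / (1 - α)))
    rw [hlog, hh t, funext hh]
    refine hderiv.congr_deriv ?_
    simp only [id]
    ring
end

section
/- Let α ∈ ℕ with α ≥ 2 and let c ∈ ℝ with c ≠ 0. If a formal power series f = Σ_{i≥0} γ_i X^i over ℝ satisfies Julia's functional equation for Φ(X) = c·X^α as an identity of formal power series, i.e. c·α·X^{α−1}·f(X) = f(c·X^α) (equivalently, comparing coefficients: for every m ∈ ℕ, c·α·γ_{m−(α−1)} if m ≥ α−1 (and 0 otherwise) equals c^{m/α}·γ_{m/α} if α divides m (and 0 otherwise)), then f = 0; that is, no non-trivial formal power series solution of Julia's functional equation exists for Φ(x) = c·x^α with α ≥ 2. -/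
/-- No non-trivial formal power series `f = Σ γ_i X^i` solves Julia's functional equation
`c·α·X^{α-1}·f(X) = f(c·X^α)` for `Φ(X) = c·X^α` with `α ≥ 2`, `c ≠ 0`; the functional
equation is expressed by comparing coefficients of `X^m`. -/
theorem stmt_9 (α : ℕ) (hα : 2 ≤ α) (c : ℝ) (hc : c ≠ 0) (γ : ℕ → ℝ)
    (hJulia : ∀ m : ℕ,
      (if α - 1 ≤ m then c * (α : ℝ) * γ (m - (α - 1)) else 0)
        = (if α ∣ m then c ^ (m / α) * γ (m / α) else 0)) :
    ∀ i : ℕ, γ i = 0 := by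
  have hα0 : (α : ℝ) ≠ 0 := by
    have : α ≠ 0 := by omega
    exact_mod_cast this
  have hα1 : (α : ℝ) - 1 ≠ 0 := by
    have : α ≠ 1 := by omega
    exact sub_ne_zero.mpr (by exact_mod_cast this)
  intro i
  induction i using Nat.strong_induction_on with
  | _ i ih =>
    rcases Nat.lt_trichotomy i 1 with hi | rfl | hi
    · obtain rfl : i = 0 := by omega
      have h := hJulia 0
      rw [if_neg (by omega), if_pos (dvd_zero α)] at h
      simpa using h.symm
    · have h := hJulia α
      rw [if_pos (by omega), if_pos dvd_rfl, Nat.div_self (by omega),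
        show α - (α - 1) = 1 by omega, pow_one] at h
      have h' : c * ((α : ℝ) - 1) * γ 1 = 0 := by linear_combination h
      exact (mul_eq_zero.mp h').resolve_left (mul_ne_zero hc hα1)
    · have h := hJulia (i + (α - 1))
      have hlt : (i + (α - 1)) / α < i := by
        rw [Nat.div_lt_iff_lt_mul (by omega)]
        obtain ⟨a, rfl⟩ := Nat.exists_eq_add_of_le hα
        obtain ⟨j, rfl⟩ := Nat.exists_eq_add_of_le (Nat.succ_le_of_lt hi)
        rw [show 2 + a - 1 = 1 + a by omega]
        norm_num
        nlinarith [Nat.zero_le (j * a)]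
      rw [if_pos (by omega), Nat.add_sub_cancel, ih _ hlt, mul_zero, ite_self] at h
      exact (mul_eq_zero.mp h).resolve_left (mul_ne_zero hc hα0)
end

section
/- Let T > 0, let X ⊆ ℝ be open, let f : ℝ → ℝ and g : ℝ → ℝ be continuous, and let Φ : X → ℝ be differentiable. Suppose that for every x ∈ X there is a differentiable function h_x : [0,T] → ℝ with h_x'(t) = f(h_x(t))·g(t) for all t ∈ [0,T], h_x(0) = x, h_x(T) = Φ(x), and f(h_x(t)) ≠ 0 for all t ∈ [0,T]. Then f and Φ satisfy Julia's functional equation: Φ'(x)·f(x) = f(Φ(x)) for all x ∈ X. -/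
/-- On an order-connected set where a continuous function `f` does not vanish, the reciprocal
`1 / f` has the antiderivative `y ↦ ∫ u in a..y, (f u)⁻¹`. -/
theorem hasDerivAt_integral_inv_of_ne_zero {f : ℝ → ℝ} (hf : Continuous f) {C : Set ℝ}
    (hC : C.OrdConnected) (hne : ∀ y ∈ C, f y ≠ 0) {a y : ℝ} (ha : a ∈ C) (hy : y ∈ C) :
    HasDerivAt (fun z => ∫ u in a..z, (f u)⁻¹) (f y)⁻¹ y := by
  refine intervalIntegral.integral_hasDerivAt_right ?_ ?_ (hf.continuousAt.inv₀ (hne y hy))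
  · exact (hf.continuousOn.inv₀ fun u hu => hne u (hC.uIcc_subset ha hy hu)).intervalIntegrable
  · exact hf.measurable.inv.stronglyMeasurable.stronglyMeasurableAtFilter

/-- If the solution of the separable ODE `h' = f(h)·g(t)` with `h(0) = x` satisfies the
time-T constraint `h_x(T) = Φ(x)` and `f` does not vanish along solutions, then `f` and
`Φ` satisfy Julia's functional equation `Φ'(x)·f(x) = f(Φ(x))`. -/
theorem stmt_10 (T : ℝ) (hT : 0 < T) (X : Set ℝ) (hX : IsOpen X)
    (f g : ℝ → ℝ) (hf : Continuous f) (hg : Continuous g)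
    (Φ : ℝ → ℝ) (hΦ : ∀ x ∈ X, DifferentiableAt ℝ Φ x)
    (h : ℝ → ℝ → ℝ)
    (hderiv : ∀ x ∈ X, ∀ t ∈ Set.Icc (0:ℝ) T, HasDerivAt (h x) (f (h x t) * g t) t)
    (hinit : ∀ x ∈ X, h x 0 = x)
    (hfinal : ∀ x ∈ X, h x T = Φ x)
    (hne : ∀ x ∈ X, ∀ t ∈ Set.Icc (0:ℝ) T, f (h x t) ≠ 0) :
    ∀ x ∈ X, deriv Φ x * f x = f (Φ x) := by
  intro x hx
  have h0 : (0 : ℝ) ∈ Set.Icc 0 T := ⟨le_rfl, hT.le⟩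
  have h1 : T ∈ Set.Icc 0 T := ⟨hT.le, le_rfl⟩
  set C := connectedComponentIn {y | f y ≠ 0} x with hCdef
  have hopen : IsOpen {y | f y ≠ 0} := isOpen_ne_fun hf continuous_const
  have hCopen : IsOpen C := hopen.connectedComponentIn
  have hfx : f x ≠ 0 := by simpa [hinit x hx] using hne x hx 0 h0
  have hxC : x ∈ C := mem_connectedComponentIn hfx
  have hCord : C.OrdConnected := isPreconnected_connectedComponentIn.ordConnected
  have hCne : ∀ y ∈ C, f y ≠ 0 := fun y hy => connectedComponentIn_subset _ _ hy
  have hmaps : ∀ y ∈ X ∩ C, ∀ t ∈ Set.Icc 0 T, h y t ∈ C := by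
    rintro y ⟨hyX, hyC⟩ t ht
    have hpre : IsPreconnected (h y '' Set.Icc 0 T) :=
      isPreconnected_Icc.image _ fun s hs => (hderiv y hyX s hs).continuousAt.continuousWithinAt
    rw [hCdef, connectedComponentIn_eq hyC]
    refine hpre.subset_connectedComponentIn ⟨0, h0, hinit y hyX⟩ ?_ ⟨t, ht, rfl⟩
    rintro _ ⟨s, hs, rfl⟩
    exact hne y hyX s hs
  set F : ℝ → ℝ := fun z => ∫ u in x..z, (f u)⁻¹
  have hF : ∀ y ∈ C, HasDerivAt F (f y)⁻¹ y := fun y hy =>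
    hasDerivAt_integral_inv_of_ne_zero hf hCord hCne hxC hy
  have htime : ∀ y ∈ X ∩ C, F (Φ y) = F y + ∫ t in (0 : ℝ)..T, g t := by
    intro y hy
    have hint := intervalIntegral.integral_eq_sub_of_hasDerivAt (a := 0) (b := T)
      (f := fun t => F (h y t)) (f' := g) (fun t ht => by
        rw [Set.uIcc_of_le hT.le] at ht
        have hd := (hF _ (hmaps y hy t ht)).comp t (hderiv y hy.1 t ht)
        rwa [inv_mul_cancel_left₀ (hne y hy.1 t ht)] at hd) (hg.intervalIntegrable 0 T)
    simp only [hinit y hy.1, hfinal y hy.1] at hint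
    linarith
  have hΦC : Φ x ∈ C := hfinal x hx ▸ hmaps x ⟨hx, hxC⟩ T h1
  have hleft : HasDerivAt (fun y => F (Φ y)) ((f (Φ x))⁻¹ * deriv Φ x) x :=
    (hF _ hΦC).comp x (hΦ x hx).hasDerivAt
  have hright : HasDerivAt (fun y => F (Φ y)) (f x)⁻¹ x :=
    ((hF x hxC).add_const _).congr_of_eventuallyEq
      (Filter.eventually_of_mem ((hX.inter hCopen).mem_nhds ⟨hx, hxC⟩) htime)
  have heq := hleft.unique hright
  have hfΦ := hCne _ hΦC
  field_simp at heq
  linarith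
end

section
/- Let I ⊆ ℝ be an open interval containing 0 and let h : ℝⁿ × I → ℝⁿ be differentiable in both variables, satisfying the initial condition h(x, 0) = x for all x ∈ ℝⁿ and the translation equation h(x, s + t) = h(h(x, s), t) for all x ∈ ℝⁿ and all s, t ∈ I with s + t ∈ I. Define f : ℝⁿ → ℝⁿ by f(x) = ∂_t h(x, t)|_{t=0}. Then for all x ∈ ℝⁿ and t ∈ I the three Jabotinsky equations hold: (J1) ∂_t h(x, t) = D_x h(x, t)·f(x), (J2) ∂_t h(x, t) = f(h(x, t)), and (J3) D_x h(x, t)·f(x) = f(h(x, t)), where D_x h(x, t) denotes the Jacobian matrix of h with respect to x. -/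
/-- A map `h` satisfying the initial condition `h(x,0) = x` and the translation equation,
differentiable in both variables, satisfies the three Jabotinsky equations with vector
field `f(x) = ∂_t h(x,t)|_{t=0}`. -/
theorem stmt_11 (n : ℕ) (a b : ℝ) (ha : a < 0) (hb : 0 < b)
    (h : (Fin n → ℝ) → ℝ → (Fin n → ℝ))
    (ht : (Fin n → ℝ) → ℝ → (Fin n → ℝ))
    (hht : ∀ x : Fin n → ℝ, ∀ t ∈ Set.Ioo a b, HasDerivAt (h x) (ht x t) t)
    (Dx : (Fin n → ℝ) → ℝ → ((Fin n → ℝ) →L[ℝ] (Fin n → ℝ)))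
    (hDx : ∀ x : Fin n → ℝ, ∀ t ∈ Set.Ioo a b, HasFDerivAt (fun y => h y t) (Dx x t) x)
    (hinit : ∀ x : Fin n → ℝ, h x 0 = x)
    (htrans : ∀ x : Fin n → ℝ, ∀ s ∈ Set.Ioo a b, ∀ t ∈ Set.Ioo a b,
      s + t ∈ Set.Ioo a b → h x (s + t) = h (h x s) t)
    (f : (Fin n → ℝ) → (Fin n → ℝ)) (hf : ∀ x, f x = ht x 0) :
    ∀ x : Fin n → ℝ, ∀ t ∈ Set.Ioo a b,
      ht x t = Dx x t (f x) ∧ ht x t = f (h x t) ∧ Dx x t (f x) = f (h x t) := by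
  intro x t htI
  have h0 : (0 : ℝ) ∈ Set.Ioo a b := ⟨ha, hb⟩
  have hs : ∀ᶠ s in nhds (0 : ℝ), s ∈ Set.Ioo a b := isOpen_Ioo.mem_nhds h0
  have hst : ∀ᶠ s in nhds (0 : ℝ), s + t ∈ Set.Ioo a b :=
    (continuous_id.add continuous_const).continuousAt.eventually_mem
      (isOpen_Ioo.mem_nhds (by simpa using htI))
  have shift : HasDerivAt (fun s => h x (s + t)) (ht x t) 0 :=
    HasDerivAt.comp_add_const 0 t (by simpa using hht x t htI)
  have J1 : ht x t = Dx x t (f x) := by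
    have chain : HasDerivAt (fun s => h (h x s) t) (Dx x t (f x)) 0 := by
      have hD : HasFDerivAt (fun y => h y t) (Dx x t) (h x 0) := by
        rw [hinit]
        exact hDx x t htI
      rw [hf]
      exact hD.comp_hasDerivAt 0 (hht x 0 h0)
    refine shift.unique (chain.congr_of_eventuallyEq ?_)
    filter_upwards [hs, hst] with s h1 h2 using htrans x s h1 t htI h2
  have J2 : ht x t = f (h x t) := by
    rw [hf]
    refine shift.unique ((hht (h x t) 0 h0).congr_of_eventuallyEq ?_)
    filter_upwards [hs, hst] with s h1 h2
    rw [add_comm] at h2 ⊢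
    exact htrans x t htI s h1 h2
  exact ⟨J1, J2, J1.symm.trans J2⟩
end

section
/- Let X ⊆ ℝ be an open interval, let f : ℝ → ℝ be continuous with f(x) ≠ 0 for all x ∈ X, and let r : X → ℝ be differentiable with r'(x) = 1/f(x) for all x ∈ X; then r is strictly monotone and has an inverse ρ : r(X) → X. Define h(x, t) = ρ(r(x) + t) for all (x, t) with x ∈ X and r(x) + t ∈ r(X). Then h(x, 0) = x; h is differentiable in t with ∂_t h(x, t) = f(h(x, t)) (the second Jabotinsky equation); and h satisfies the translation equation h(x, s + t) = h(h(x, s), t) whenever both sides are defined. -/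
/-- With `r' = 1/f` on the open interval `X` (where `f` is continuous and nonvanishing),
`r` is strictly monotone with inverse `ρ`, and `h(x,t) = ρ(r(x)+t)` satisfies the initial
condition, the second Jabotinsky equation `∂_t h = f(h)`, and the translation equation
wherever both sides are defined. -/
theorem stmt_12 (X : Set ℝ) (hX : IsOpen X) (hXc : X.OrdConnected)
    (f : ℝ → ℝ) (hf : Continuous f) (hfne : ∀ x ∈ X, f x ≠ 0)
    (r : ℝ → ℝ) (hr : ∀ x ∈ X, HasDerivAt r (1 / f x) x)
    (ρ : ℝ → ℝ) (hρ₁ : ∀ x ∈ X, ρ (r x) = x)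
    (hρ₂ : ∀ y ∈ r '' X, ρ y ∈ X ∧ r (ρ y) = y) :
    (StrictMonoOn r X ∨ StrictAntiOn r X) ∧
    (∀ x ∈ X, ρ (r x + 0) = x) ∧
    (∀ x ∈ X, ∀ t : ℝ, r x + t ∈ r '' X →
      HasDerivAt (fun τ => ρ (r x + τ)) (f (ρ (r x + t))) t) ∧
    (∀ x ∈ X, ∀ s t : ℝ, r x + s ∈ r '' X → r x + (s + t) ∈ r '' X →
      r (ρ (r x + s)) + t ∈ r '' X →
      ρ (r x + (s + t)) = ρ (r (ρ (r x + s)) + t)) := by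
  have hconv : Convex ℝ X := hXc.convex
  have hcont : ContinuousOn r X := fun x hx => (hr x hx).continuousAt.continuousWithinAt
  refine ⟨?_, fun x hx => by rw [add_zero, hρ₁ x hx], ?_, ?_⟩
  · by_cases hneg : ∃ a ∈ X, f a < 0
    · obtain ⟨a, ha, hfa⟩ := hneg
      right
      refine strictAntiOn_of_deriv_neg hconv hcont fun x hx => ?_
      have hxX := interior_subset hx
      rw [(hr x hxX).deriv, one_div, inv_lt_zero]
      by_contra! hfx
      obtain ⟨z, hz, hfz⟩ := hXc.isPreconnected.intermediate_value ha hxX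
        hf.continuousOn ⟨hfa.le, hfx⟩
      exact hfne z hz hfz
    · push Not at hneg
      left
      refine strictMonoOn_of_deriv_pos hconv hcont fun x hx => ?_
      have hxX := interior_subset hx
      rw [(hr x hxX).deriv]
      exact one_div_pos.2 ((hneg x hxX).lt_of_ne' (hfne x hxX))
  · rintro x - t ⟨y, hy, hyt⟩
    have hstrict : HasStrictDerivAt r (1 / f y) y :=
      hasStrictDerivAt_of_hasDerivAt_of_continuousAt
        (Filter.eventually_of_mem (hX.mem_nhds hy) hr)
        (continuousAt_const.div hf.continuousAt (hfne y hy))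
    have hinv := (hstrict.to_local_left_inverse (one_div_ne_zero (hfne y hy))
      (Filter.eventually_of_mem (hX.mem_nhds hy) hρ₁)).hasDerivAt
    rw [hyt, one_div, inv_inv] at hinv
    rw [← hyt, hρ₁ y hy]
    exact hinv.comp_const_add (r x) t
  · intro x _ s t hs _ _
    rw [(hρ₂ _ hs).2, add_assoc]
end

section
/- Let X ⊆ ℝ be open, k ≥ 2, Ψ : X → ℝ be (k+1)-times continuously differentiable, and p ∈ X with Ψ^{(j)}(p) = 0 for all 1 ≤ j < k and Ψ^{(k)}(p) = γ ≠ 0. Then there exist an open neighborhood U of 0 ∈ ℝ and a C¹ map μ : U → ℝ which is a diffeomorphism onto its image, with μ(0) = p and μ(U) ⊆ X, such that Ψ(μ(u)) = Ψ(p) + (sign(γ))^{k−1}·u^k for all u ∈ U. -/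
open Filter Topology in
/-- The leading Taylor coefficient as a limit of quotients. -/
theorem tendsto_div_sub_pow_of_iteratedDeriv_eq_zero (n : ℕ) (f : ℝ → ℝ) (p : ℝ)
    (hf : ContDiffAt ℝ n f p) (h0 : ∀ j < n, iteratedDeriv j f p = 0) :
    Tendsto (fun x => f x / (x - p) ^ n) (𝓝[≠] p) (𝓝 (iteratedDeriv n f p / n.factorial)) := by
  induction n generalizing f with
  | zero => simpa using hf.continuousAt.tendsto.mono_left nhdsWithin_le_nhds
  | succ n ih =>
    have hf' : ContDiffAt ℝ n (deriv f) p := hf.derivWithin (by norm_cast)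
    have hlim := ih (deriv f) hf' (fun j hj => by
      rw [← iteratedDeriv_succ']; exact h0 _ (by omega))
    have hdiff : ∀ᶠ x in 𝓝 p, DifferentiableAt ℝ f x :=
      (hf.eventually (by simp)).mono fun x hx => hx.differentiableAt (by simp)
    have hfp : f p = 0 := by simpa using h0 0 (by omega)
    refine HasDerivAt.lhopital_zero_nhdsNE (f' := deriv f)
      (g' := fun x => ((n + 1 : ℕ) : ℝ) * (x - p) ^ n)
      ((hdiff.filter_mono nhdsWithin_le_nhds).mono fun x hx => hx.hasDerivAt)
      (Eventually.of_forall fun x => ?_) ?_ ?_ ?_ ?_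
    · simpa using ((hasDerivAt_id' x).sub_const p).fun_pow (n + 1)
    · filter_upwards [self_mem_nhdsWithin] with x hx
      have : x - p ≠ 0 := sub_ne_zero.2 hx
      positivity
    · simpa [hfp] using hf.continuousAt.tendsto.mono_left nhdsWithin_le_nhds
    · have : ContinuousAt (fun x : ℝ => (x - p) ^ (n + 1)) p := by fun_prop
      simpa using this.tendsto.mono_left nhdsWithin_le_nhds
    · rw [iteratedDeriv_succ']
      convert hlim.div_const ((n + 1 : ℕ) : ℝ) using 2
      · rw [div_div, mul_comm]
      · rw [Nat.factorial_succ, div_div]; push_cast; ring_nf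

open Filter Topology in
/-- A function vanishing to exact order `n + 1` is locally the `(n + 1)`-st power of a `C¹`
function with nonzero derivative. -/
theorem exists_contDiffAt_pow_eq (n : ℕ) (F : ℝ → ℝ) (p c : ℝ) (hc : 0 < c)
    (hF : ContDiffAt ℝ 1 F p) (hFp : F p = 0)
    (hG : Tendsto (fun x => F x / (x - p) ^ (n + 1)) (𝓝[≠] p) (𝓝 c))
    (hK : Tendsto (fun x => deriv F x / (x - p) ^ n) (𝓝[≠] p) (𝓝 ((n + 1) * c))) :
    ∃ h : ℝ → ℝ, ∃ d : ℝ, d ≠ 0 ∧ ContDiffAt ℝ 1 h p ∧ HasDerivAt h d p ∧ h p = 0 ∧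
      ∀ᶠ x in 𝓝 p, h x ^ (n + 1) = F x := by
  have hn : (n : ℝ) + 1 ≠ 0 := by positivity
  set r : ℝ := ((n : ℝ) + 1)⁻¹ with hr
  set G := Function.update (fun x => F x / (x - p) ^ (n + 1)) p c with hGdef
  set K := Function.update (fun x => deriv F x / (x - p) ^ n) p ((n + 1) * c) with hKdef
  have hGp : G p = c := by simp [hGdef]
  have hKp : K p = (n + 1) * c := by simp [hKdef]
  have hGne : ∀ x ≠ p, G x = F x / (x - p) ^ (n + 1) := fun x hx => by simp [hGdef, hx]
  have hKne : ∀ x ≠ p, K x = deriv F x / (x - p) ^ n := fun x hx => by simp [hKdef, hx]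
  have hGc : ContinuousAt G p := continuousAt_update_same.2 hG
  have hKc : ContinuousAt K p := continuousAt_update_same.2 hK
  have hGpos : ∀ᶠ x in 𝓝 p, 0 < G x := hGc.eventually (by rw [hGp]; exact lt_mem_nhds hc)
  have hF1 : ∀ᶠ x in 𝓝 p, ContDiffAt ℝ 1 F x := hF.eventually (by simp)
  have hslope : HasDerivAt (fun x => (x - p) * G x ^ r) (c ^ r) p := by
    rw [hasDerivAt_iff_tendsto_slope]
    have : Tendsto (fun x => G x ^ r) (𝓝[≠] p) (𝓝 (c ^ r)) := by
      have h := hGc.rpow_const (p := r) (Or.inl (by rw [hGp]; exact hc.ne'))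
      simpa [ContinuousAt, hGp] using h.tendsto.mono_left nhdsWithin_le_nhds
    refine this.congr' ?_
    filter_upwards [self_mem_nhdsWithin] with x hx
    have : x - p ≠ 0 := sub_ne_zero.2 hx
    simp [slope_def_field]
    field_simp
  have hderiv : ∀ᶠ x in 𝓝 p,
      HasDerivAt (fun x => (x - p) * G x ^ r) (r * G x ^ (r - 1) * K x) x := by
    filter_upwards [hGpos, hF1] with x hGx hFx
    rcases eq_or_ne x p with rfl | hx
    · convert hslope using 1
      rw [hGp, hKp, Real.rpow_sub_one hc.ne', hr]
      field_simp
    · have hxp : x - p ≠ 0 := sub_ne_zero.2 hx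
      have hid : HasDerivAt (fun x => x - p) 1 x := (hasDerivAt_id' x).sub_const p
      have hq := (hFx.differentiableAt (by simp)).hasDerivAt.fun_div (hid.fun_pow (n + 1))
        (pow_ne_zero _ hxp)
      have hGx' := hq.congr_of_eventuallyEq
        (show G =ᶠ[𝓝 x] _ from (eventually_ne_nhds hx).mono fun y hy => hGne y hy)
      refine (hid.fun_mul (hGx'.rpow_const (p := r) (Or.inl hGx.ne'))).congr_deriv ?_
      have e1 : F x = G x * (x - p) ^ (n + 1) := by rw [hGne x hx]; field_simp
      have e2 : deriv F x = K x * (x - p) ^ n := by rw [hKne x hx]; field_simp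
      rw [Real.rpow_sub_one hGx.ne', hr]
      simp only [e1, e2]
      push_cast
      have := hGx.ne'
      field_simp
      ring
  have hpow : ∀ᶠ x in 𝓝 p, ((x - p) * G x ^ r) ^ (n + 1) = F x := by
    filter_upwards [hGpos] with x hGx
    rcases eq_or_ne x p with rfl | hx
    · simp [hFp]
    · have hxp : x - p ≠ 0 := sub_ne_zero.2 hx
      have : (G x ^ r) ^ (n + 1) = G x := by
        rw [hr]; exact_mod_cast Real.rpow_inv_natCast_pow hGx.le (Nat.succ_ne_zero n)
      rw [mul_pow, this, hGne x hx]
      field_simp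
  refine ⟨fun x => (x - p) * G x ^ r, c ^ r, (Real.rpow_pos_of_pos hc r).ne', ?_, hslope,
    by simp, hpow⟩
  have hcont : ∀ᶠ x in 𝓝 p, ContinuousAt (fun x => r * G x ^ (r - 1) * K x) x := by
    filter_upwards [hGpos, hF1] with x hGx hFx
    have key : ContinuousAt G x ∧ ContinuousAt K x := by
      rcases eq_or_ne x p with rfl | hx
      · exact ⟨hGc, hKc⟩
      · have hxp : x - p ≠ 0 := sub_ne_zero.2 hx
        have hd : ContinuousAt (deriv F) x :=
          (hFx.derivWithin (m := 0) (by simp)).continuousAt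
        have hFc := hFx.continuousAt
        constructor
        · refine (continuousAt_update_of_ne hx).2 (hFc.div (by fun_prop) (pow_ne_zero _ hxp))
        · refine (continuousAt_update_of_ne hx).2 (hd.div (by fun_prop) (pow_ne_zero _ hxp))
    exact (continuousAt_const.mul (key.1.rpow_const (Or.inl hGx.ne'))).mul key.2
  rw [contDiffAt_one_iff]
  refine ⟨fun x => ContinuousLinearMap.toSpanSingleton ℝ (r * G x ^ (r - 1) * K x), _,
    hderiv.and hcont, fun x hx => ?_, fun x hx => hx.1.hasFDerivAt⟩
  exact ((ContinuousLinearMap.toSpanSingletonCLE (𝕜 := ℝ) (E := ℝ)).continuous.continuousAt.comp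
    hx.2).continuousWithinAt

open Filter Topology in
/-- Normal form near a degenerate critical point: if the first `k-1` derivatives of a
`C^{k+1}` function vanish at `p` and the `k`-th derivative is `γ ≠ 0`, then there is a
local `C¹` diffeomorphism `μ` onto its image with `μ(0) = p` such that
`Ψ(μ(u)) = Ψ(p) + sign(γ)^{k-1}·u^k`. -/
theorem stmt_15 (X : Set ℝ) (hX : IsOpen X) (k : ℕ) (hk : 2 ≤ k)
    (Ψ : ℝ → ℝ) (hΨ : ContDiffOn ℝ (k + 1 : ℕ) Ψ X)
    (p : ℝ) (hp : p ∈ X)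
    (hjzero : ∀ j : ℕ, 1 ≤ j → j < k → iteratedDerivWithin j Ψ X p = 0)
    (γ : ℝ) (hγ : iteratedDerivWithin k Ψ X p = γ) (hγne : γ ≠ 0) :
    ∃ U : Set ℝ, IsOpen U ∧ (0:ℝ) ∈ U ∧
      ∃ μ : ℝ → ℝ, ContDiffOn ℝ 1 μ U ∧ Set.InjOn μ U ∧ μ 0 = p ∧ μ '' U ⊆ X ∧
        (∃ ν : ℝ → ℝ, ContDiffOn ℝ 1 ν (μ '' U) ∧ ∀ u ∈ U, ν (μ u) = u) ∧
        ∀ u ∈ U, Ψ (μ u) = Ψ p + (Real.sign γ) ^ (k - 1) * u ^ k := by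
  obtain ⟨n, rfl⟩ : ∃ n, k = n + 1 := ⟨k - 1, by omega⟩
  have hΨp : ContDiffAt ℝ (n + 1 + 1 : ℕ) Ψ p := hΨ.contDiffAt (hX.mem_nhds hp)
  have hΨd : ContDiffAt ℝ (n + 1 : ℕ) (deriv Ψ) p := hΨp.derivWithin (by norm_cast)
  have hγ' : iteratedDeriv (n + 1) Ψ p = γ := by
    rw [← hγ, iteratedDerivWithin_of_isOpen hX hp]
  have hz : ∀ j, 1 ≤ j → j < n + 1 → iteratedDeriv j Ψ p = 0 := fun j h1 h2 => by
    rw [← hjzero j h1 h2, iteratedDerivWithin_of_isOpen hX hp]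
  have hdsub : deriv (fun x => Ψ x - Ψ p) = deriv Ψ := by
    ext x; exact deriv_sub_const _
  set s : ℝ := Real.sign γ with hs
  have hs2 : s * s = 1 := by
    rcases lt_or_gt_of_ne hγne with h | h
    · simp [hs, Real.sign_of_neg h]
    · simp [hs, Real.sign_of_pos h]
  have hsγ : 0 < s * γ := by
    rcases lt_or_gt_of_ne hγne with h | h
    · simpa [hs, Real.sign_of_neg h]
    · simpa [hs, Real.sign_of_pos h]
  have hG := tendsto_div_sub_pow_of_iteratedDeriv_eq_zero (n + 1) (fun x => Ψ x - Ψ p) p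
    ((hΨp.of_le (by norm_cast; omega)).sub contDiffAt_const) (fun j hj => by
      rcases j with _ | j
      · simp
      · rw [iteratedDeriv_succ', hdsub, ← iteratedDeriv_succ']
        exact hz _ (by omega) hj)
  rw [iteratedDeriv_succ', hdsub, ← iteratedDeriv_succ', hγ'] at hG
  have hK := tendsto_div_sub_pow_of_iteratedDeriv_eq_zero n (deriv Ψ) p
    (hΨd.of_le (by norm_cast; omega)) (fun j hj => by
      rw [← iteratedDeriv_succ']; exact hz _ (by omega) (by omega))
  rw [← iteratedDeriv_succ', hγ'] at hK
  obtain ⟨h, d, hd, hC, hD, h0, hpow⟩ := exists_contDiffAt_pow_eq n (fun x => s * (Ψ x - Ψ p)) p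
    (s * (γ / (n + 1).factorial)) (by rw [← mul_div_assoc]; positivity)
    (contDiffAt_const.mul ((hΨp.of_le (by norm_cast; omega)).sub contDiffAt_const)) (by simp)
    (by simpa only [mul_div_assoc] using hG.const_mul s)
    (by
      convert hK.const_mul s using 2
      · rw [deriv_const_mul_field, hdsub, mul_div_assoc]
      · rw [Nat.factorial_succ]; push_cast; field_simp)
  have hs0 : s ≠ 0 := fun h => by simp [h] at hs2
  have hC' : ContDiffAt ℝ 1 (fun x => s * h x) p := contDiffAt_const.mul hC
  have hD' := (hD.const_mul s).hasFDerivAt_equiv (mul_ne_zero hs0 hd)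
  have hν0 : s * h p = 0 := by simp [h0]
  set e := hC'.toOpenPartialHomeomorph _ hD' one_ne_zero
  have hecoe : ∀ x, e x = s * h x := fun x => rfl
  have hpe : p ∈ e.source := hC'.mem_toOpenPartialHomeomorph_source hD' one_ne_zero
  have h0t : (0 : ℝ) ∈ e.target := by
    have := e.map_source hpe
    rwa [hecoe, hν0] at this
  have hsymm0 : e.symm 0 = p := by
    have := e.left_inv hpe
    rwa [hecoe, hν0] at this
  have hμ : ContDiffAt ℝ 1 e.symm 0 :=
    e.contDiffAt_symm h0t (by rw [hsymm0]; exact hD') (by rw [hsymm0]; exact hC')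
  obtain ⟨V, hV, hVo, hpV⟩ := eventually_nhds_iff.1
    (hpow.and ((hX.eventually_mem hp).and (hC'.eventually (by simp))))
  obtain ⟨W, hW, hWo, h0W⟩ := eventually_nhds_iff.1 (hμ.eventually (by simp))
  refine ⟨(e.target ∩ e.symm ⁻¹' V) ∩ W, (e.isOpen_inter_preimage_symm hVo).inter hWo,
    ⟨⟨h0t, by simpa [hsymm0] using hpV⟩, h0W⟩, e.symm,
    fun u hu => (hW u hu.2).contDiffWithinAt,
    e.symm.injOn.mono fun u hu => hu.1.1, hsymm0, ?_, ⟨e, ?_, fun u hu => e.right_inv hu.1.1⟩, ?_⟩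
  · rintro _ ⟨u, hu, rfl⟩
    exact (hV _ hu.1.2).2.1
  · rintro _ ⟨u, hu, rfl⟩
    exact (hV _ hu.1.2).2.2.contDiffWithinAt
  · intro u hu
    have h1 : s * h (e.symm u) = u := e.right_inv hu.1.1
    have h2 := (hV _ hu.1.2).1
    have h3 : s ^ n * (s * h (e.symm u)) ^ (n + 1) = s * (s * s) ^ n * h (e.symm u) ^ (n + 1) := by
      ring
    rw [h1, hs2, h2] at h3
    rw [Nat.add_sub_cancel, h3]
    linear_combination (Ψ p - Ψ (e.symm u)) * hs2
end

section
/- Let n ≥ 1, let X ⊆ ℝⁿ be open, and let Φ : X → ℝᵐ be continuous. Suppose some component Φ_i of Φ has a topologically critical point of index k: there exist p ∈ X, an integer k with 0 ≤ k ≤ n, a neighborhood U of 0 in ℝⁿ, and a homeomorphism μ from U onto its image μ(U) ⊆ X with μ(0) = p such that Φ_i(μ(u)) = Φ_i(p) − Σ_{j=1}^{k} u_j² + Σ_{j=k+1}^{n} u_j² for all u ∈ U. Then there exist no continuous injective map H : X → ℝⁿ, matrix A ∈ ℝ^{m×n}, and vector a ∈ ℝᵐ such that Φ(x) = A·H(x)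 + a for all x ∈ X. In particular, Φ cannot be embedded in a neural ODE with a linear layer (whose time-T map, under existence and uniqueness of solutions, is continuous and injective). -/
open Module in
/-- A real endomorphism of an odd-dimensional space has an eigenvalue. -/
theorem exists_hasEigenvalue_of_odd_finrank {V : Type*} [AddCommGroup V] [Module ℝ V]
    (hV : Odd (finrank ℝ V)) (f : End ℝ V) : ∃ c, f.HasEigenvalue c := by
  have : FiniteDimensional ℝ V := FiniteDimensional.of_finrank_pos hV.pos
  set P := f.charpoly with hP
  have hdeg : P.natDegree = finrank ℝ V := f.charpoly_natDegree
  have hmon : P.Monic := f.charpoly_monic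
  have hpos : 0 < P.degree := by
    rw [← Polynomial.natDegree_pos_iff_degree_pos, hdeg]; exact hV.pos
  have htop : Filter.Tendsto (fun x => P.eval x) Filter.atTop Filter.atTop :=
    P.tendsto_atTop_of_leadingCoeff_nonneg hpos (by rw [hmon.leadingCoeff]; exact zero_le_one)
  have hnat : (P.comp (-Polynomial.X)).natDegree = P.natDegree := by
    rw [Polynomial.natDegree_comp]; simp
  have hbot' : Filter.Tendsto (fun x => (P.comp (-Polynomial.X)).eval x)
      Filter.atTop Filter.atBot := by
    apply Polynomial.tendsto_atBot_of_leadingCoeff_nonpos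
    · rw [← Polynomial.natDegree_pos_iff_degree_pos, hnat, hdeg]; exact hV.pos
    · rw [Polynomial.leadingCoeff_comp (by simp), hmon.leadingCoeff, hdeg]
      simp [hV.neg_one_pow]
  have hbot : Filter.Tendsto (fun x => P.eval x) Filter.atBot Filter.atBot := by
    have := hbot'.comp Filter.tendsto_neg_atBot_atTop
    simpa [Function.comp_def] using this
  obtain ⟨c, hc⟩ := P.continuous.surjective htop hbot 0
  exact ⟨c, (f.hasEigenvalue_iff_isRoot_charpoly c).2 hc⟩

open Module in
/-- A commutative algebra acting on an odd-dimensional real vector space has a common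
eigenvector. -/
theorem exists_common_eigenvector_of_odd_finrank {A : Type*} [CommRing A] [Algebra ℝ A]
    {M : Type*} [AddCommGroup M] [Module A M] [Module ℝ M] [IsScalarTower ℝ A M]
    (hM : Odd (finrank ℝ M)) : ∃ v : M, v ≠ 0 ∧ ∀ a : A, ∃ c : ℝ, a • v = c • v := by
  induction hk : finrank ℝ M using Nat.strong_induction_on generalizing M with
  | _ k ih =>
  have hfin : FiniteDimensional ℝ M := FiniteDimensional.of_finrank_pos hM.pos
  by_cases hall : ∀ a : A, ∃ c : ℝ, ∀ v : M, a • v = c • v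
  · have : Nontrivial M := nontrivial_of_finrank_pos hM.pos
    obtain ⟨v, hv⟩ := exists_ne (0 : M)
    exact ⟨v, hv, fun a => (hall a).imp fun c hc => hc v⟩
  push Not at hall
  obtain ⟨a, ha⟩ := hall
  have hsub : ∀ N : Submodule A M, Odd (finrank ℝ N) → finrank ℝ N < k →
      ∃ v : M, v ≠ 0 ∧ ∀ a : A, ∃ c : ℝ, a • v = c • v := by
    intro N hN hlt
    obtain ⟨v, hv, h⟩ := ih _ hlt hN rfl
    refine ⟨v, by simpa using hv, fun a => (h a).imp fun c hc => ?_⟩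
    simpa using congrArg Subtype.val hc
  obtain ⟨c, hc⟩ := exists_hasEigenvalue_of_odd_finrank hM (Algebra.lsmul ℝ ℝ M a)
  obtain ⟨w, hw⟩ := hc.exists_hasEigenvector
  have hwe : a • w = c • w := by simpa using hw.apply_eq_smul
  let T : M →ₗ[A] M := LinearMap.lsmul A M (a - algebraMap ℝ A c)
  have hT : ∀ v, T v = a • v - c • v := fun v => by simp [T]
  have hsum : finrank ℝ (LinearMap.range T) + finrank ℝ (LinearMap.ker T) = k := by
    rw [← hk]; exact LinearMap.finrank_range_add_finrank_ker (T.restrictScalars ℝ)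
  have hker : 0 < finrank ℝ (LinearMap.ker T) := by
    have : Nontrivial (LinearMap.ker T) :=
      ⟨⟨w, by simp [hT, hwe]⟩, 0, fun h => hw.2 (congrArg Subtype.val h)⟩
    have : Module.Finite ℝ (LinearMap.ker T) :=
      inferInstanceAs (Module.Finite ℝ (LinearMap.ker (T.restrictScalars ℝ)))
    exact finrank_pos
  have hrange : 0 < finrank ℝ (LinearMap.range T) := by
    obtain ⟨v, hv⟩ := ha c
    have : Nontrivial (LinearMap.range T) :=
      ⟨⟨T v, v, rfl⟩, 0, fun h => hv (sub_eq_zero.1 ((hT v).symm.trans (congrArg Subtype.val h)))⟩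
    have : Module.Finite ℝ (LinearMap.range T) :=
      inferInstanceAs (Module.Finite ℝ (LinearMap.range (T.restrictScalars ℝ)))
    exact finrank_pos
  rw [hk, ← hsum, Nat.odd_add] at hM
  rcases Nat.even_or_odd (finrank ℝ (LinearMap.ker T)) with h | h
  · exact hsub _ (hM.2 h) (by omega)
  · exact hsub _ h (by omega)

namespace MvPolynomial

variable {σ : Type*}

/-- A linear map does not increase the total degree if it does not on monomials. -/
theorem totalDegree_le_of_monomial (T : MvPolynomial σ ℝ →ₗ[ℝ] MvPolynomial σ ℝ)
    (hT : ∀ a, (T (monomial a 1)).totalDegree ≤ a.degree) (q : MvPolynomial σ ℝ) :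
    (T q).totalDegree ≤ q.totalDegree := by
  conv_lhs => rw [q.as_sum, map_sum]
  refine totalDegree_finsetSum_le fun a ha => ?_
  have h : monomial a (q.coeff a) = q.coeff a • monomial a (1 : ℝ) := by
    simp [smul_monomial]
  rw [h, map_smul]
  exact (totalDegree_smul_le _ _).trans ((hT a).trans (le_totalDegree ha))

theorem degree_sub_single_add {d : ℕ} {a : σ →₀ ℕ} {i : σ} (h : d ≤ a i) :
    (a - Finsupp.single i d).degree + d = a.degree := by
  have : a - Finsupp.single i d + Finsupp.single i d = a :=
    tsub_add_cancel_of_le (by simpa using h)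
  conv_rhs => rw [← this]
  simp

/-- A system of real polynomial equations whose coordinate ring has odd dimension has a real
solution. -/
theorem exists_eval_eq_zero_of_odd_finrank
    {I : Ideal (MvPolynomial σ ℝ)}
    (hI : Odd (Module.finrank ℝ (MvPolynomial σ ℝ ⧸ I))) :
    ∃ y : σ → ℝ, ∀ q ∈ I, eval y q = 0 := by
  obtain ⟨v, hv, h⟩ := exists_common_eigenvector_of_odd_finrank (A := MvPolynomial σ ℝ) hI
  choose c hc using h
  have hev : ∀ q : MvPolynomial σ ℝ, q • v = eval (fun i => c (X i)) q • v := by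
    intro q
    induction q using MvPolynomial.induction_on with
    | C r => rw [eval_C, ← algebraMap_eq, algebraMap_smul]
    | add q r hq hr => rw [add_smul, hq, hr, map_add, add_smul]
    | mul_X q i hq =>
      rw [mul_smul, hc, smul_comm, hq, smul_smul, map_mul, eval_X, mul_comm]
  refine ⟨fun i => c (X i), fun q hq => ?_⟩
  have h0 : q • v = 0 := by
    obtain ⟨w, rfl⟩ := Ideal.Quotient.mk_surjective v
    change Ideal.Quotient.mk I (q * w) = 0
    exact Ideal.Quotient.eq_zero_iff_mem.2 (I.mul_mem_right _ hq)
  rw [hev] at h0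
  exact (smul_eq_zero.1 h0).resolve_right hv

variable [Fintype σ]

/-- An injective linear endomorphism which does not increase the total degree is surjective on
the polynomials of bounded degree. -/
theorem exists_preimage_of_injective_of_totalDegree_le
    (T : MvPolynomial σ ℝ →ₗ[ℝ] MvPolynomial σ ℝ)
    (hT : ∀ q, (T q).totalDegree ≤ q.totalDegree) (hinj : Function.Injective T)
    (q : MvPolynomial σ ℝ) : ∃ r, r.totalDegree ≤ q.totalDegree ∧ T r = q := by
  let W := restrictTotalDegree σ ℝ q.totalDegree
  have hW : ∀ r ∈ W, T r ∈ W := fun r hr => by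
    rw [mem_restrictTotalDegree] at hr ⊢
    exact (hT r).trans hr
  have hinj' : Function.Injective (T.restrict hW) := fun x y hxy =>
    Subtype.ext (hinj (congrArg Subtype.val hxy))
  obtain ⟨⟨r, hr⟩, h⟩ := LinearMap.surjective_of_injective hinj'
    ⟨q, (mem_restrictTotalDegree _ _ _).2 le_rfl⟩
  exact ⟨r, (mem_restrictTotalDegree _ _ _).1 hr, congrArg Subtype.val h⟩

/-- A linear endomorphism which does not increase the total degree and is surjective on
the polynomials of bounded degree is injective. -/
theorem injective_of_exists_preimage
    (T : MvPolynomial σ ℝ →ₗ[ℝ] MvPolynomial σ ℝ)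
    (hT : ∀ q, (T q).totalDegree ≤ q.totalDegree)
    (hsurj : ∀ q, ∃ r, r.totalDegree ≤ q.totalDegree ∧ T r = q) :
    Function.Injective T := by
  rw [← LinearMap.ker_eq_bot, LinearMap.ker_eq_bot']
  intro q hq
  let W := restrictTotalDegree σ ℝ q.totalDegree
  have hW : ∀ r ∈ W, T r ∈ W := fun r hr => by
    rw [mem_restrictTotalDegree] at hr ⊢
    exact (hT r).trans hr
  have hsurj' : Function.Surjective (T.restrict hW) := by
    rintro ⟨s, hs⟩
    obtain ⟨r, hr, rfl⟩ := hsurj s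
    have hr' := hr.trans ((mem_restrictTotalDegree _ _ _).1 hs)
    exact ⟨⟨r, (mem_restrictTotalDegree _ _ _).2 hr'⟩, rfl⟩
  have hinj := LinearMap.injective_iff_surjective.2 hsurj'
  have := @hinj ⟨q, (mem_restrictTotalDegree _ _ _).2 le_rfl⟩ 0 (Subtype.ext (by simpa using hq))
  exact congrArg Subtype.val this

/-- Replace one factor `X i ^ d` in a monomial by `f i`, when there is one. -/
noncomputable def substPow (d : ℕ) (f : σ → MvPolynomial σ ℝ) :
    MvPolynomial σ ℝ →ₗ[ℝ] MvPolynomial σ ℝ :=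
  open Classical in
  (basisMonomials σ ℝ).constr ℝ fun a =>
    if h : ∃ i, d ≤ a i then monomial (a - Finsupp.single h.choose d) 1 * f h.choose else 0

/-- Replace every factor `X i ^ d` in a monomial by `p i`. -/
noncomputable def substAllPow (d : ℕ) (p : σ → MvPolynomial σ ℝ) :
    MvPolynomial σ ℝ →ₗ[ℝ] MvPolynomial σ ℝ :=
  (basisMonomials σ ℝ).constr ℝ fun a =>
    monomial (a.mapRange (· % d) (Nat.zero_mod d)) 1 * ∏ i, p i ^ (a i / d)

theorem substPow_monomial_of_exists {d : ℕ} (f : σ → MvPolynomial σ ℝ) {a : σ →₀ ℕ}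
    (h : ∃ i, d ≤ a i) : ∃ i, d ≤ a i ∧
      substPow d f (monomial a 1) = monomial (a - Finsupp.single i d) 1 * f i := by
  refine ⟨h.choose, h.choose_spec, ?_⟩
  have := (basisMonomials σ ℝ).constr_basis ℝ (fun a => open Classical in
    if h : ∃ i, d ≤ a i then monomial (a - Finsupp.single h.choose d) 1 * f h.choose else 0) a
  rw [coe_basisMonomials] at this
  rw [substPow, this, dif_pos h]

theorem substPow_monomial_of_not_exists {d : ℕ} (f : σ → MvPolynomial σ ℝ) {a : σ →₀ ℕ}
    (h : ¬ ∃ i, d ≤ a i) : substPow d f (monomial a 1) = 0 := by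
  have := (basisMonomials σ ℝ).constr_basis ℝ (fun a => open Classical in
    if h : ∃ i, d ≤ a i then monomial (a - Finsupp.single h.choose d) 1 * f h.choose else 0) a
  rw [coe_basisMonomials] at this
  rw [substPow, this, dif_neg h]

theorem substAllPow_monomial (d : ℕ) (p : σ → MvPolynomial σ ℝ) (a : σ →₀ ℕ) :
    substAllPow d p (monomial a 1) =
      monomial (a.mapRange (· % d) (Nat.zero_mod d)) 1 * ∏ i, p i ^ (a i / d) := by
  have := (basisMonomials σ ℝ).constr_basis ℝ (fun a =>
    monomial (a.mapRange (· % d) (Nat.zero_mod d)) 1 * ∏ i, p i ^ (a i / d)) a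
  rwa [coe_basisMonomials] at this

theorem totalDegree_substPow_le {d : ℕ} {f : σ → MvPolynomial σ ℝ}
    (hf : ∀ i, (f i).totalDegree ≤ d) (q : MvPolynomial σ ℝ) :
    (substPow d f q).totalDegree ≤ q.totalDegree := by
  refine totalDegree_le_of_monomial _ (fun a => ?_) q
  by_cases h : ∃ i, d ≤ a i
  · obtain ⟨i, hi, h⟩ := substPow_monomial_of_exists f h
    rw [h, ← degree_sub_single_add hi]
    exact (totalDegree_mul _ _).trans (add_le_add (totalDegree_monomial_le _ _) (hf i))
  · simp [substPow_monomial_of_not_exists f h]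

theorem totalDegree_substAllPow_le {d : ℕ} {p : σ → MvPolynomial σ ℝ}
    (hp : ∀ i, (p i).totalDegree ≤ d) (q : MvPolynomial σ ℝ) :
    (substAllPow d p q).totalDegree ≤ q.totalDegree := by
  refine totalDegree_le_of_monomial _ (fun a => ?_) q
  rw [substAllPow_monomial]
  have h1 : (a.mapRange (· % d) (Nat.zero_mod d)).degree + ∑ i, (a i / d) * d = a.degree := by
    simp only [Finsupp.degree_eq_sum, Finsupp.mapRange_apply, ← Finset.sum_add_distrib]
    exact Finset.sum_congr rfl fun i _ => Nat.mod_add_div' _ _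
  rw [← h1]
  refine (totalDegree_mul _ _).trans (add_le_add (totalDegree_monomial_le _ _) ?_)
  refine (totalDegree_finsetProd _ _).trans (Finset.sum_le_sum fun i _ => ?_)
  exact (totalDegree_pow _ _).trans (Nat.mul_le_mul_left _ (hp i))

theorem substAllPow_X_pow_mul {d : ℕ} (hd : 0 < d) (p : σ → MvPolynomial σ ℝ) (i : σ)
    (q : MvPolynomial σ ℝ) : substAllPow d p (X i ^ d * q) = p i * substAllPow d p q := by
  classical
  suffices h : substAllPow d p ∘ₗ LinearMap.mulLeft ℝ (X i ^ d) =
      LinearMap.mulLeft ℝ (p i) ∘ₗ substAllPow d p from LinearMap.congr_fun h q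
  refine (basisMonomials σ ℝ).ext fun a => ?_
  simp only [coe_basisMonomials, LinearMap.comp_apply, LinearMap.mulLeft_apply]
  rw [X_pow_eq_monomial, monomial_mul, one_mul, substAllPow_monomial, substAllPow_monomial]
  have h1 : (Finsupp.single i d + a).mapRange (· % d) (Nat.zero_mod d) =
      a.mapRange (· % d) (Nat.zero_mod d) := by
    ext j
    rcases eq_or_ne i j with rfl | h <;> simp [*]
  have h2 : ∏ j, p j ^ ((Finsupp.single i d + a) j / d) = p i * ∏ j, p j ^ (a j / d) := by
    have : ∀ j, p j ^ ((Finsupp.single i d + a) j / d) =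
        (if j = i then p i else 1) * p j ^ (a j / d) := by
      intro j
      rcases eq_or_ne j i with rfl | h
      · simp [Nat.add_div_left _ hd, pow_succ, mul_comm]
      · simp [h]
    rw [Finset.prod_congr rfl fun j _ => this j, Finset.prod_mul_distrib]
    simp
  rw [h1, h2]
  ring

theorem countable_setOf_hasEigenvalue (T : Module.End ℝ (MvPolynomial σ ℝ)) :
    {c : ℝ | T.HasEigenvalue c}.Countable := by
  have hex : ∀ c : {c : ℝ | T.HasEigenvalue c}, ∃ v, T.HasEigenvector c v :=
    fun c => c.2.exists_hasEigenvector
  choose v hv using hex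
  have hli := Module.End.eigenvectors_linearIndependent T _ v hv
  have h1 := hli.cardinal_lift_le_rank
  rw [← (basisMonomials σ ℝ).mk_eq_rank''] at h1
  rw [← Set.countable_coe_iff, ← Cardinal.mk_le_aleph0_iff]
  have h2 := h1.trans (Cardinal.lift_le.2 (Cardinal.mk_le_aleph0 (α := σ →₀ ℕ)))
  simpa using h2

/-- If `ε` is generic, the polynomials `f i + ε X i ^ d` behave like `X i ^ d`. -/
theorem bijective_substAllPow {d : ℕ} (hd : 0 < d) {f : σ → MvPolynomial σ ℝ}
    (hf : ∀ i, (f i).totalDegree ≤ d) {ε : ℝ}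
    (hε : ¬ Module.End.HasEigenvalue (substPow d f) (-ε)) :
    Function.Bijective (substAllPow d fun i => f i + ε • X i ^ d) := by
  set p : σ → MvPolynomial σ ℝ := fun i => f i + ε • X i ^ d with hpdef
  have hp : ∀ i, (p i).totalDegree ≤ d := fun i => by
    refine (totalDegree_add _ _).trans (max_le (hf i) ((totalDegree_smul_le _ _).trans ?_))
    rw [totalDegree_X_pow]
  let Ψ : MvPolynomial σ ℝ →ₗ[ℝ] MvPolynomial σ ℝ := substPow d f + ε • LinearMap.id
  have hΨ : ∀ q, Ψ q = substPow d f q + ε • q := fun q => rfl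
  have hΨdeg : ∀ q, (Ψ q).totalDegree ≤ q.totalDegree := fun q =>
    (totalDegree_add _ _).trans (max_le (totalDegree_substPow_le hf q) (totalDegree_smul_le _ _))
  have hΨinj : Function.Injective Ψ := by
    rw [← LinearMap.ker_eq_bot, LinearMap.ker_eq_bot']
    intro q hq
    by_contra hne
    refine hε (Module.End.hasEigenvalue_of_hasEigenvector (x := q)
      ⟨Module.End.mem_eigenspace_iff.2 ?_, hne⟩)
    rw [neg_smul]
    exact eq_neg_of_add_eq_zero_left hq
  have hsurj : ∀ e : ℕ, ∀ q : MvPolynomial σ ℝ, q.totalDegree ≤ e →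
      ∃ r, r.totalDegree ≤ e ∧ substAllPow d p r = q := by
    intro e
    induction e using Nat.strong_induction_on with
    | _ e ih =>
    intro q hq
    obtain ⟨s, hs, rfl⟩ := exists_preimage_of_injective_of_totalDegree_le Ψ hΨdeg hΨinj q
    suffices h : Ψ s ∈ (restrictTotalDegree σ ℝ e).map (substAllPow d p) by
      obtain ⟨r, hr, h⟩ := h
      exact ⟨r, (mem_restrictTotalDegree _ _ _).1 hr, h⟩
    rw [s.as_sum, map_sum]
    refine Submodule.sum_mem _ fun a ha => ?_
    have hae : a.degree ≤ e := ((le_totalDegree ha).trans hs).trans hq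
    have h : monomial a (s.coeff a) = s.coeff a • monomial a (1 : ℝ) := by
      simp [smul_monomial]
    rw [h, map_smul]
    refine Submodule.smul_mem _ _ ?_
    rw [hΨ]
    by_cases hbox : ∃ i, d ≤ a i
    · obtain ⟨i, hi, hbox⟩ := substPow_monomial_of_exists f hbox
      have hdeg := degree_sub_single_add hi
      obtain ⟨r, hr, hrV⟩ := ih (e - d) (by omega) (monomial (a - Finsupp.single i d) 1)
        ((totalDegree_monomial_le _ _).trans (by change Finsupp.degree _ ≤ _; omega))
      refine ⟨X i ^ d * r, (mem_restrictTotalDegree _ _ _).2 ?_, ?_⟩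
      · refine (totalDegree_mul _ _).trans ?_
        rw [totalDegree_X_pow]
        omega
      · rw [substAllPow_X_pow_mul hd, hrV, hbox, hpdef]
        have hmon : monomial a (1 : ℝ) = monomial (a - Finsupp.single i d) 1 * X i ^ d := by
          rw [X_pow_eq_monomial, monomial_mul, one_mul,
            tsub_add_cancel_of_le (by simpa using hi)]
        rw [hmon]
        simp only [smul_eq_C_mul]
        ring
    · rw [substPow_monomial_of_not_exists f hbox, zero_add]
      refine Submodule.smul_mem _ _ ⟨monomial a 1, (mem_restrictTotalDegree _ _ _).2
        ((totalDegree_monomial_le _ _).trans hae), ?_⟩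
      push Not at hbox
      have h1 : a.mapRange (· % d) (Nat.zero_mod d) = a := by
        ext j
        simp [Nat.mod_eq_of_lt (hbox j)]
      rw [substAllPow_monomial, h1]
      simp [Nat.div_eq_of_lt (hbox _)]
  refine ⟨injective_of_exists_preimage _ (totalDegree_substAllPow_le hp)
    fun q => hsurj _ q le_rfl, fun q => ?_⟩
  obtain ⟨r, -, hr⟩ := hsurj _ q le_rfl
  exact ⟨r, hr⟩

/-- If the products of the `p i ^ (a i / d)` with the reduced monomials form a basis of the
polynomial ring, then the quotient by all `p i` has dimension `d ^ n`. -/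
theorem finrank_quotient_span_range {d : ℕ} (hd : 0 < d) {p : σ → MvPolynomial σ ℝ}
    (hbij : Function.Bijective (substAllPow d p)) :
    Module.finrank ℝ (MvPolynomial σ ℝ ⧸ Ideal.span (Set.range p)) = d ^ Fintype.card σ := by
  classical
  let V : MvPolynomial σ ℝ ≃ₗ[ℝ] MvPolynomial σ ℝ := LinearEquiv.ofBijective _ hbij
  have hV : ∀ q, V q = substAllPow d p q := fun q => rfl
  let box : (σ → Fin d) → (σ →₀ ℕ) := fun b => Finsupp.equivFunOnFinite.symm fun i => (b i : ℕ)
  have hbox : ∀ b i, box b i = b i := fun b i => rfl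
  let R : MvPolynomial σ ℝ →ₗ[ℝ] ((σ → Fin d) → ℝ) := LinearMap.pi fun b => lcoeff ℝ (box b)
  have hR : ∀ q b, R q b = coeff (box b) q := fun q b => rfl
  have hRsurj : Function.Surjective R := by
    intro g
    refine ⟨∑ b, monomial (box b) (g b), ?_⟩
    ext b
    have hinj : Function.Injective box := fun b b' h =>
      _root_.funext fun i => Fin.ext (DFunLike.congr_fun h i)
    simp [hR, coeff_sum, coeff_monomial, hinj.eq_iff]
  let π : MvPolynomial σ ℝ →ₗ[ℝ] ((σ → Fin d) → ℝ) := R ∘ₗ V.symm.toLinearMap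
  have hπsurj : Function.Surjective π := hRsurj.comp V.symm.surjective
  have hker : (Ideal.span (Set.range p)).restrictScalars ℝ = LinearMap.ker π := by
    ext q
    rw [Submodule.restrictScalars_mem, LinearMap.mem_ker]
    constructor
    · intro hq
      obtain ⟨c, rfl⟩ := Ideal.mem_span_range_iff_exists_fun.1 hq
      rw [map_sum]
      refine Finset.sum_eq_zero fun i _ => ?_
      have h1 : c i * p i = V (X i ^ d * V.symm (c i)) := by
        rw [hV, substAllPow_X_pow_mul hd, ← hV, V.apply_symm_apply, mul_comm]
      rw [h1]
      simp only [π, LinearMap.comp_apply, LinearEquiv.coe_coe, V.symm_apply_apply]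
      ext b
      rw [hR, X_pow_eq_monomial, coeff_monomial_mul', if_neg]
      · rfl
      · intro h
        have := h i
        rw [Finsupp.single_eq_same, hbox] at this
        exact absurd (b i).2 (not_lt.2 this)
    · intro hq
      obtain ⟨r, rfl⟩ := V.surjective q
      simp only [π, LinearMap.comp_apply, LinearEquiv.coe_coe, V.symm_apply_apply] at hq
      rw [r.as_sum, map_sum]
      refine Submodule.sum_mem _ fun a ha => ?_
      have h : monomial a (r.coeff a) = r.coeff a • monomial a (1 : ℝ) := by
        simp [smul_monomial]
      have hout : ∃ i, d ≤ a i := by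
        by_contra hcon
        push Not at hcon
        have h1 : box (fun i => ⟨a i, hcon i⟩) = a := Finsupp.ext fun i => rfl
        have h2 := congrFun hq fun i => ⟨a i, hcon i⟩
        rw [hR, h1] at h2
        exact mem_support_iff.1 ha h2
      obtain ⟨i, hi⟩ := hout
      have hmon : monomial a (1 : ℝ) = X i ^ d * monomial (a - Finsupp.single i d) 1 := by
        rw [X_pow_eq_monomial, monomial_mul, one_mul,
          add_tsub_cancel_of_le (by simpa using hi)]
      rw [h, map_smul, hV, hmon, substAllPow_X_pow_mul hd, smul_eq_C_mul]
      exact Ideal.mul_mem_left _ _ (Ideal.mul_mem_right _ _ (Ideal.subset_span ⟨i, rfl⟩))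
  have e : (MvPolynomial σ ℝ ⧸ Ideal.span (Set.range p)) ≃ₗ[ℝ] ((σ → Fin d) → ℝ) :=
    (Submodule.Quotient.restrictScalarsEquiv ℝ (Ideal.span (Set.range p))).symm.trans
      ((Submodule.quotEquivOfEq _ _ hker).trans (π.quotKerEquivOfSurjective hπsurj))
  rw [e.finrank_eq]
  simp

/-- Polynomials `f i` of degree at most `d`, with `d` odd and as many polynomials as variables,
acquire a common real zero after an arbitrarily small multiple of `X i ^ d` is added. -/
theorem exists_eval_add_pow_eq_zero {d : ℕ} (hd : Odd d) {f : σ → MvPolynomial σ ℝ}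
    (hf : ∀ i, (f i).totalDegree ≤ d) {δ : ℝ} (hδ : 0 < δ) :
    ∃ ε ∈ Set.Ioo 0 δ, ∃ y : σ → ℝ, ∀ i, eval y (f i) + ε * y i ^ d = 0 := by
  have hcount := countable_setOf_hasEigenvalue (substPow d f)
  have hunc : ¬ (Set.Ioo (-δ) 0).Countable := fun h => by
    have h1 := Cardinal.mk_Ioo_real (neg_lt_zero.2 hδ)
    have h2 := Cardinal.le_aleph0_iff_set_countable.2 h
    rw [h1] at h2
    exact absurd Cardinal.aleph0_lt_continuum (not_lt.2 h2)
  obtain ⟨c, hc, hne⟩ := Set.not_subset.1 fun h => hunc (hcount.mono h)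
  have hne' : ¬ Module.End.HasEigenvalue (substPow d f) (-(-c)) := by rwa [neg_neg]
  have hbij := bijective_substAllPow hd.pos hf hne'
  have hfin := finrank_quotient_span_range hd.pos hbij
  obtain ⟨y, hy⟩ := exists_eval_eq_zero_of_odd_finrank (hfin ▸ hd.pow)
  refine ⟨-c, ⟨neg_pos.2 hc.2, neg_lt.1 hc.1⟩, y, fun i => ?_⟩
  simpa [smul_eq_C_mul] using hy _ (Ideal.subset_span ⟨i, rfl⟩)

end MvPolynomial

/-- The central projection of affine space onto the open upper hemisphere. -/
noncomputable def toHemisphere {m : ℕ} (y : Fin m → ℝ) : Fin (m + 1) → ℝ :=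
  (√(1 + ∑ j, y j ^ 2))⁻¹ • Fin.cons 1 y

theorem sqrt_one_add_sum_sq_pos {m : ℕ} (y : Fin m → ℝ) : 0 < √(1 + ∑ j, y j ^ 2) := by
  positivity

theorem sum_sq_toHemisphere {m : ℕ} (y : Fin m → ℝ) : ∑ j, toHemisphere y j ^ 2 = 1 := by
  have h : (√(1 + ∑ j, y j ^ 2)) ^ 2 = 1 + ∑ j, y j ^ 2 := Real.sq_sqrt (by positivity)
  have h0 : 1 + ∑ j, y j ^ 2 ≠ 0 := by positivity
  simp only [toHemisphere, Pi.smul_apply, smul_eq_mul, mul_pow, ← Finset.mul_sum, inv_pow, h,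
    Fin.sum_univ_succ, Fin.cons_zero, Fin.cons_succ, one_pow]
  exact inv_mul_cancel₀ h0

open MvPolynomial in
/-- The odd part of a polynomial, restricted to the hemisphere and seen in the affine chart,
becomes polynomial after multiplication with an odd power of the length. -/
theorem exists_eval_eq_odd_part {m d : ℕ} (hd : Odd d) (q : MvPolynomial (Fin (m + 1)) ℝ)
    (hq : q.totalDegree ≤ d) : ∃ P : MvPolynomial (Fin m) ℝ, P.totalDegree ≤ d ∧
      ∀ y, eval y P = (√(1 + ∑ j, y j ^ 2)) ^ d *
        ((eval (toHemisphere y) q - eval (-toHemisphere y) q) / 2) := by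
  have hmon : ∀ a : Fin (m + 1) →₀ ℕ, a.degree ≤ d → ∃ P : MvPolynomial (Fin m) ℝ,
      P.totalDegree ≤ d ∧ ∀ y, eval y P = (√(1 + ∑ j, y j ^ 2)) ^ d *
        ((∏ j, toHemisphere y j ^ a j - ∏ j, (-toHemisphere y) j ^ a j) / 2) := by
    intro a ha
    have hneg : ∀ u : Fin (m + 1) → ℝ, ∏ j, (-u) j ^ a j = (-1) ^ a.degree * ∏ j, u j ^ a j := by
      intro u
      rw [Finsupp.degree_eq_sum, ← Finset.prod_pow_eq_pow_sum, ← Finset.prod_mul_distrib]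
      exact Finset.prod_congr rfl fun j _ => by rw [← mul_pow]; simp
    rcases Nat.even_or_odd a.degree with he | ho
    · exact ⟨0, by simp, fun y => by rw [hneg, he.neg_one_pow]; simp⟩
    obtain ⟨k, hk⟩ : ∃ k, d = a.degree + 2 * k := by
      obtain ⟨k, hk⟩ := Nat.Odd.sub_odd hd ho
      exact ⟨k, by omega⟩
    refine ⟨(∏ j, (Fin.cons 1 X : Fin (m + 1) → MvPolynomial (Fin m) ℝ) j ^ a j) *
      (1 + ∑ j, X j ^ 2) ^ k, ?_, fun y => ?_⟩
    · rw [hk, Finsupp.degree_eq_sum]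
      refine (totalDegree_mul _ _).trans (add_le_add ?_ ?_)
      · refine (totalDegree_finsetProd _ _).trans (Finset.sum_le_sum fun j _ => ?_)
        refine (totalDegree_pow _ _).trans ?_
        refine (Nat.mul_le_mul_left _ (?_ : _ ≤ 1)).trans (mul_one _).le
        refine Fin.cases ?_ (fun i => ?_) j
        · simp
        · simp
      · refine (totalDegree_pow _ _).trans ?_
        rw [mul_comm 2]
        refine Nat.mul_le_mul_left _ ((totalDegree_add _ _).trans (max_le (by simp) ?_))
        exact totalDegree_finsetSum_le fun j _ => by rw [totalDegree_X_pow]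
    · have hs := sqrt_one_add_sum_sq_pos y
      have h2 : (√(1 + ∑ j, y j ^ 2)) ^ 2 = 1 + ∑ j, y j ^ 2 := Real.sq_sqrt (by positivity)
      have hcons : ∀ j, eval y ((Fin.cons 1 X : Fin (m + 1) → MvPolynomial (Fin m) ℝ) j) =
          √(1 + ∑ j, y j ^ 2) * toHemisphere y j := by
        intro j
        rw [toHemisphere, Pi.smul_apply, smul_eq_mul, mul_inv_cancel_left₀ hs.ne']
        refine Fin.cases ?_ (fun i => ?_) j <;> simp
      generalize √(1 + ∑ j, y j ^ 2) = s at hs h2 hcons ⊢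
      rw [hneg, ho.neg_one_pow, map_mul, map_prod, map_pow, map_add, map_sum]
      simp only [map_pow, hcons, map_one, eval_X, ← h2, mul_pow, Finset.prod_mul_distrib,
        Finset.prod_pow_eq_pow_sum]
      rw [← Finsupp.degree_eq_sum, hk]
      ring
  have hex : ∀ a : Fin (m + 1) →₀ ℕ, ∃ P : MvPolynomial (Fin m) ℝ, a ∈ q.support →
      P.totalDegree ≤ d ∧ ∀ y, eval y P = (√(1 + ∑ j, y j ^ 2)) ^ d *
        ((∏ j, toHemisphere y j ^ a j - ∏ j, (-toHemisphere y) j ^ a j) / 2) := by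
    intro a
    by_cases ha : a ∈ q.support
    · obtain ⟨P, hP⟩ := hmon a ((le_totalDegree ha).trans hq)
      exact ⟨P, fun _ => hP⟩
    · exact ⟨0, fun h => absurd h ha⟩
  choose P hP using hex
  refine ⟨∑ a ∈ q.support, q.coeff a • P a, ?_, fun y => ?_⟩
  · exact totalDegree_finsetSum_le fun a ha => (totalDegree_smul_le _ _).trans (hP a ha).1
  · rw [map_sum, eval_eq', eval_eq', ← Finset.sum_sub_distrib, Finset.sum_div, Finset.mul_sum]
    refine Finset.sum_congr rfl fun a ha => ?_
    rw [smul_eval, (hP a ha).2]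
    ring

theorem isCompact_setOf_sum_sq_eq_one (n : ℕ) :
    IsCompact {x : Fin n → ℝ | ∑ j, x j ^ 2 = 1} := by
  refine isCompact_Icc.of_isClosed_subset (s := Set.Icc (-1 : Fin n → ℝ) 1)
    (isClosed_eq (by fun_prop) continuous_const) fun x hx => ?_
  have h : ∀ j, |x j| ≤ 1 := fun j => by
    rw [← sq_le_one_iff_abs_le_one, ← show _ = (1 : ℝ) from hx]
    exact Finset.single_le_sum (f := fun j => x j ^ 2) (fun _ _ => sq_nonneg _) (Finset.mem_univ j)
  exact ⟨fun j => (abs_le.1 (h j)).1, fun j => (abs_le.1 (h j)).2⟩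

open MvPolynomial in
/-- Continuous functions on a compact subset of `ℝⁿ` are uniform limits of polynomials. -/
theorem exists_mvPolynomial_near {n : ℕ} {K : Set (Fin n → ℝ)} (hK : IsCompact K)
    {g : (Fin n → ℝ) → ℝ} (hg : ContinuousOn g K) {δ : ℝ} (hδ : 0 < δ) :
    ∃ q : MvPolynomial (Fin n) ℝ, ∀ x ∈ K, |eval x q - g x| < δ := by
  have : CompactSpace K := isCompact_iff_compactSpace.1 hK
  let coord : Fin n → C(K, ℝ) := fun j => ⟨fun x => x.1 j, (continuous_apply j).comp continuous_subtype_val⟩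
  let A : Subalgebra ℝ C(K, ℝ) := (aeval (R := ℝ) coord).range
  have hA : A.SeparatesPoints := by
    intro x y hxy
    obtain ⟨j, hj⟩ := Function.ne_iff.1 (Subtype.coe_injective.ne hxy)
    exact ⟨coord j, ⟨coord j, ⟨X j, by simp⟩, rfl⟩, hj⟩
  obtain ⟨⟨_, q, rfl⟩, hq⟩ :=
    ContinuousMap.exists_mem_subalgebra_near_continuous_of_separatesPoints A hA
      (fun x : K => g x) hg.domRestrict δ hδ
  have heval : ∀ x : K, aeval (R := ℝ) coord q x = eval x.1 q := by
    intro x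
    clear hq
    induction q using MvPolynomial.induction_on with
    | C r => simp
    | add p q hp hq => simp [hp, hq]
    | mul_X p i hp => rw [map_mul, map_mul, ContinuousMap.mul_apply, hp, aeval_X, eval_X]; rfl
  exact ⟨q, fun x hx => by simpa [heval] using hq ⟨x, hx⟩⟩

/-- The **Borsuk–Ulam theorem**: an odd continuous map from the unit sphere in `ℝᵐ⁺¹` to `ℝᵐ` has
a zero. -/
theorem borsuk_ulam {m : ℕ} {f : (Fin (m + 1) → ℝ) → (Fin m → ℝ)}
    (hf : ContinuousOn f {x | ∑ j, x j ^ 2 = 1})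
    (hodd : ∀ x, ∑ j, x j ^ 2 = 1 → f (-x) = -f x) :
    ∃ x, ∑ j, x j ^ 2 = 1 ∧ f x = 0 := by
  have hcomp := isCompact_setOf_sum_sq_eq_one (m + 1)
  have happrox : ∀ δ : ℝ, 0 < δ → ∃ u, ∑ j, u j ^ 2 = 1 ∧ ∀ i, |f u i| ≤ 2 * δ := by
    intro δ hδ
    choose q hq using fun i => exists_mvPolynomial_near hcomp
      (g := fun x => f x i) ((continuous_apply i).comp_continuousOn hf) hδ
    let d := 2 * (∑ i, (q i).totalDegree) + 1
    have hd : Odd d := ⟨_, rfl⟩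
    have hqd : ∀ i, (q i).totalDegree ≤ d := fun i => by
      have := Finset.single_le_sum (f := fun i => (q i).totalDegree) (fun _ _ => Nat.zero_le _)
        (Finset.mem_univ i)
      omega
    choose P hPd hP using fun i => exists_eval_eq_odd_part hd (q i) (hqd i)
    obtain ⟨ε, ⟨hε0, hεδ⟩, y, hy⟩ := MvPolynomial.exists_eval_add_pow_eq_zero hd hPd hδ
    have hu := sum_sq_toHemisphere y
    have hs := sqrt_one_add_sum_sq_pos y
    have hyu : ∀ i, y i = √(1 + ∑ j, y j ^ 2) * toHemisphere y i.succ := fun i => by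
      rw [toHemisphere, Pi.smul_apply, smul_eq_mul, mul_inv_cancel_left₀ hs.ne', Fin.cons_succ]
    refine ⟨toHemisphere y, hu, fun i => ?_⟩
    have hy' := hy i
    rw [hP, hyu i] at hy'
    set u := toHemisphere y
    rw [mul_pow, mul_left_comm, ← mul_add] at hy'
    have hzero := (mul_eq_zero.1 hy').resolve_left (pow_pos hs d).ne'
    have hui : |u i.succ ^ d| ≤ 1 := by
      rw [abs_pow]
      refine pow_le_one₀ (abs_nonneg _) ?_
      rw [← sq_le_one_iff_abs_le_one, ← hu]
      exact Finset.single_le_sum (f := fun j => u j ^ 2) (fun _ _ => sq_nonneg _)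
        (Finset.mem_univ _)
    have h1 := abs_lt.1 (hq i u hu)
    have h2 := abs_lt.1 (hq i (-u) (by simpa using hu))
    have h3 : f (-u) i = -f u i := by rw [hodd u hu]; rfl
    simp only [h3] at h2
    have h4 := abs_le.1 hui
    rw [abs_le]
    constructor <;> nlinarith
  obtain ⟨x, hx, hmin⟩ := hcomp.exists_isMinOn
    ⟨toHemisphere 0, sum_sq_toHemisphere 0⟩ hf.norm
  refine ⟨x, hx, ?_⟩
  by_contra hne
  have hpos : 0 < ‖f x‖ := norm_pos_iff.2 hne
  obtain ⟨u, hu, hfu⟩ := happrox (‖f x‖ / 4) (by positivity)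
  have h1 : ‖f u‖ ≤ 2 * (‖f x‖ / 4) := (pi_norm_le_iff_of_nonneg (by positivity)).2 hfu
  have h2 : ‖f x‖ ≤ ‖f u‖ := hmin hu
  linarith

/-- A function on a neighbourhood of the origin which is even there is not a nonzero linear
functional of a continuous injective map to the space itself. -/
theorem not_exists_linear_comp_injective_of_even {m : ℕ} {U : Set (Fin (m + 1) → ℝ)}
    (hU : U ∈ nhds 0) {G : (Fin (m + 1) → ℝ) → (Fin (m + 1) → ℝ)} (hG : ContinuousOn G U)
    (hinj : Set.InjOn G U) {w : Fin (m + 1) → ℝ} (hw : w ≠ 0)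
    (heven : ∀ u ∈ U, -u ∈ U → w ⬝ᵥ G (-u) = w ⬝ᵥ G u) : False := by
  obtain ⟨j, hj⟩ := Function.ne_iff.1 hw
  obtain ⟨r, hr, hrU⟩ := Metric.nhds_basis_closedBall.mem_iff.1 hU
  have hmem : ∀ x : Fin (m + 1) → ℝ, ∑ j, x j ^ 2 = 1 → r • x ∈ U := by
    intro x hx
    refine hrU ?_
    have h1 : ‖x‖ ≤ 1 := (pi_norm_le_iff_of_nonneg zero_le_one).2 fun j => by
      rw [Real.norm_eq_abs, ← sq_le_one_iff_abs_le_one, ← hx]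
      exact Finset.single_le_sum (f := fun j => x j ^ 2) (fun _ _ => sq_nonneg _)
        (Finset.mem_univ j)
    rw [mem_closedBall_zero_iff, norm_smul, Real.norm_of_nonneg hr.le]
    exact mul_le_of_le_one_right hr.le h1
  have hneg : ∀ x : Fin (m + 1) → ℝ, ∑ j, x j ^ 2 = 1 → ∑ j, (-x) j ^ 2 = 1 :=
    fun x hx => by simpa using hx
  let f : (Fin (m + 1) → ℝ) → (Fin m → ℝ) := fun x i =>
    G (r • x) (j.succAbove i) - G (r • -x) (j.succAbove i)
  have hc1 : ContinuousOn (fun x => G (r • x)) {x | ∑ j, x j ^ 2 = 1} :=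
    hG.comp (by fun_prop) hmem
  have hc2 : ContinuousOn (fun x => G (r • -x)) {x | ∑ j, x j ^ 2 = 1} :=
    hG.comp (by fun_prop) fun x hx => hmem _ (hneg x hx)
  have hf : ContinuousOn f {x | ∑ j, x j ^ 2 = 1} := continuousOn_pi.2 fun i =>
    ((continuous_apply _).comp_continuousOn hc1).sub ((continuous_apply _).comp_continuousOn hc2)
  obtain ⟨x, hx, hfx⟩ := borsuk_ulam hf fun x _ => funext fun i => by simp [f]
  have hoff : ∀ i, G (r • x) (j.succAbove i) = G (r • -x) (j.succAbove i) := fun i =>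
    sub_eq_zero.1 (congrFun hfx i)
  have hdot : w ⬝ᵥ G (r • -x) = w ⬝ᵥ G (r • x) := by
    have := hmem _ (hneg x hx)
    rw [smul_neg] at this ⊢
    exact heven _ (hmem x hx) this
  have hGj : G (r • -x) j = G (r • x) j := by
    simp only [dotProduct, Fin.sum_univ_succAbove _ j, hoff] at hdot
    exact mul_left_cancel₀ hj (add_right_cancel hdot)
  have hGG : G (r • -x) = G (r • x) := by
    ext l
    rcases Fin.eq_self_or_eq_succAbove j l with rfl | ⟨i, rfl⟩
    · exact hGj
    · exact (hoff i).symm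
  have hxx := hinj (hmem _ (hneg x hx)) (hmem x hx) hGG
  rw [smul_neg, neg_eq_self, smul_eq_zero] at hxx
  rw [hxx.resolve_left hr.ne'] at hx
  simp at hx

/-- A continuous map one of whose components has a topologically critical point of index
`k` cannot be written as `x ↦ A·H(x) + a` with `H` continuous injective; hence it cannot
be embedded in a neural ODE with a linear layer. -/
theorem stmt_18 (n m : ℕ) (hn : 1 ≤ n) (X : Set (Fin n → ℝ)) (hX : IsOpen X)
    (Φ : (Fin n → ℝ) → (Fin m → ℝ)) (hΦ : ContinuousOn Φ X)
    (i : Fin m) (p : Fin n → ℝ) (hp : p ∈ X) (k : ℕ) (hk : k ≤ n)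
    (U : Set (Fin n → ℝ)) (hU : U ∈ nhds (0 : Fin n → ℝ))
    (μ : (Fin n → ℝ) → (Fin n → ℝ))
    (hμ0 : μ 0 = p) (hμX : μ '' U ⊆ X)
    (hμc : ContinuousOn μ U) (hμinj : Set.InjOn μ U)
    (hμinv : ∃ ν : (Fin n → ℝ) → (Fin n → ℝ),
      ContinuousOn ν (μ '' U) ∧ ∀ u ∈ U, ν (μ u) = u)
    (hmorse : ∀ u ∈ U, Φ (μ u) i
      = Φ p i + ∑ j : Fin n, (if (j : ℕ) < k then (-1 : ℝ) else 1) * (u j) ^ 2) :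
    ¬ ∃ (H : (Fin n → ℝ) → (Fin n → ℝ)) (A : Matrix (Fin m) (Fin n) ℝ) (a : Fin m → ℝ),
        ContinuousOn H X ∧ Set.InjOn H X ∧ ∀ x ∈ X, Φ x = A.mulVec (H x) + a := by
  rintro ⟨H, A, a, hHc, hHinj, hH⟩
  obtain ⟨m', rfl⟩ : ∃ m', n = m' + 1 := ⟨n - 1, by omega⟩
  have hmaps : Set.MapsTo μ U X := Set.mapsTo_iff_image_subset.2 hμX
  have hrow : ∀ u ∈ U, A i ⬝ᵥ H (μ u) + a i =
      Φ p i + ∑ j : Fin (m' + 1), (if (j : ℕ) < k then (-1 : ℝ) else 1) * (u j) ^ 2 := by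
    intro u hu
    rw [← hmorse u hu, hH _ (hmaps hu)]
    rfl
  have hA : A i ≠ 0 := by
    intro hA
    obtain ⟨r, hr, hrU⟩ := Metric.nhds_basis_closedBall.mem_iff.1 hU
    have hmem : Pi.single 0 r ∈ U := hrU (by
      rw [mem_closedBall_zero_iff, Pi.norm_single, Real.norm_of_nonneg hr.le])
    have h0 := hrow 0 (mem_of_mem_nhds hU)
    have h1 := hrow _ hmem
    rw [hA, zero_dotProduct] at h0 h1
    have h2 : ∑ j : Fin (m' + 1), (if (j : ℕ) < k then (-1 : ℝ) else 1) *
        (Pi.single 0 r : Fin (m' + 1) → ℝ) j ^ 2 = (if 0 < k then (-1 : ℝ) else 1) * r ^ 2 := by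
      rw [Fin.sum_univ_succ]
      simp only [Pi.single_eq_same, Fin.val_zero, Pi.single_eq_of_ne (Fin.succ_ne_zero _)]
      simp only [ne_eq, OfNat.ofNat_ne_zero, not_false_eq_true, zero_pow, mul_zero,
        Finset.sum_const_zero, add_zero]
      congr
    rw [h0, h2] at h1
    have hr2 := pow_pos hr 2
    split_ifs at h1 <;> simp at h1 <;> linarith
  refine not_exists_linear_comp_injective_of_even hU (G := H ∘ μ) (hHc.comp hμc hmaps)
    (hHinj.comp hμinj hmaps) hA fun u hu hu' => ?_
  have h1 := hrow u hu
  have h2 := hrow (-u) hu'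
  simp only [Pi.neg_apply, neg_sq] at h2
  exact add_right_cancel (h2.trans h1.symm)
end

section
/- Let n ≥ 1, let X ⊆ ℝⁿ be open, and let Φ : X → ℝⁿ be continuous. Suppose some component Φ_i of Φ has a topologically critical point of index k: there exist p ∈ X, an integer k with 0 ≤ k ≤ n, a neighborhood U of 0 in ℝⁿ, and a homeomorphism μ from U onto its image μ(U) ⊆ X with μ(0) = p such that Φ_i(μ(u)) = Φ_i(p) − Σ_{j=1}^{k} u_j² + Σ_{j=k+1}^{n} u_j² for all u ∈ U. Then Φ is not injective. In particular, Φ cannot equal the time-T map of a basic neural ODE, nor the first n components of the (injective, continuous) time-T map of an augmented neural ODE whose solutions return to the subspace ℝⁿ × {0}^{m−n}, since both would force Φ to be continuous and injective. -/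
open Finsupp

/-- Mod 2 chains on ordered simplices; a simplex is the list of its vertices, and the empty list
spans the augmentation degree. -/
abbrev ModTwoChain (E : Type*) := List E →₀ ZMod 2

namespace ModTwoChain

/-- The cone with apex `a`. -/
noncomputable def cone {E : Type*} (a : E) : ModTwoChain E →ₗ[ZMod 2] ModTwoChain E :=
  lmapDomain (ZMod 2) (ZMod 2) (List.cons a)

/-- The sum of the facets of a simplex. -/
noncomputable def facetSum {E : Type*} : List E → ModTwoChain E
  | [] => 0
  | a :: l => single l 1 + cone a (facetSum l)

/-- The augmented boundary operator. -/
noncomputable def bdry {E : Type*} : ModTwoChain E →ₗ[ZMod 2] ModTwoChain E :=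
  linearCombination (ZMod 2) facetSum

/-- The chain map induced by `x ↦ -x`. -/
noncomputable def antipode {E : Type*} [Neg E] : ModTwoChain E →ₗ[ZMod 2] ModTwoChain E :=
  lmapDomain (ZMod 2) (ZMod 2) (List.map Neg.neg)

/-- Chains all of whose simplices satisfy `P`. -/
noncomputable abbrev supp {E : Type*} (P : List E → Prop) : Submodule (ZMod 2) (ModTwoChain E) :=
  supported (ZMod 2) (ZMod 2) {l | P l}

theorem add_self {E : Type*} (z : ModTwoChain E) : z + z = 0 := by
  ext l
  simpa using CharTwo.add_self_eq_zero (z l)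

@[simp]
theorem cone_single {E : Type*} (a : E) (l : List E) :
    cone a (single l 1) = single (a :: l) 1 := by
  simp [cone]

@[simp]
theorem antipode_single {E : Type*} [Neg E] (l : List E) :
    antipode (single l 1) = single (l.map Neg.neg) 1 := by
  simp [antipode]

theorem bdry_single {E : Type*} (l : List E) : bdry (single l 1) = facetSum l := by
  simp [bdry]

theorem linearMap_ext {E M : Type*} [AddCommMonoid M] [Module (ZMod 2) M]
    {f g : ModTwoChain E →ₗ[ZMod 2] M} (h : ∀ l, f (single l 1) = g (single l 1)) (z) :
    f z = g z := by
  have : f = g := by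
    ext l
    simpa using h l
  rw [this]

theorem comp_ext {E : Type*} {f g f' g' : ModTwoChain E →ₗ[ZMod 2] ModTwoChain E}
    (h : ∀ l, f (g (single l 1)) = f' (g' (single l 1))) (z) : f (g z) = f' (g' z) :=
  linearMap_ext (f := f ∘ₗ g) (g := f' ∘ₗ g') h z

theorem single_mem_supp {E : Type*} {P : List E → Prop} {l : List E} (h : P l) :
    single l 1 ∈ supp P :=
  single_mem_supported _ _ h

theorem induction_supp {E : Type*} {P : List E → Prop} {M : Type*} [AddCommMonoid M]
    [Module (ZMod 2) M] (f : ModTwoChain E →ₗ[ZMod 2] M) (S : Submodule (ZMod 2) M)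
    (h : ∀ l, P l → f (single l 1) ∈ S) {z : ModTwoChain E} (hz : z ∈ supp P) : f z ∈ S := by
  rw [supp, supported_eq_span_single] at hz
  have : Submodule.span (ZMod 2) ((fun l : List E => single l (1 : ZMod 2)) '' {l | P l}) ≤
      S.comap f := by
    rw [Submodule.span_le]
    rintro _ ⟨l, hl, rfl⟩
    exact h l hl
  exact this hz

theorem eq_zero_of_mem_supp {E : Type*} {P : List E → Prop} {M : Type*} [AddCommMonoid M]
    [Module (ZMod 2) M] (f : ModTwoChain E →ₗ[ZMod 2] M)
    (h : ∀ l, P l → f (single l 1) = 0) {z : ModTwoChain E} (hz : z ∈ supp P) : f z = 0 :=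
  (Submodule.mem_bot (ZMod 2)).1
    (induction_supp f ⊥ (fun l hl => (Submodule.mem_bot (ZMod 2)).2 (h l hl)) hz)

theorem supp_mono {E : Type*} {P Q : List E → Prop} (h : ∀ l, P l → Q l) : supp P ≤ supp Q :=
  supported_mono h

theorem bdry_cone {E : Type*} (a : E) (z : ModTwoChain E) :
    bdry (cone a z) = z + cone a (bdry z) := by
  refine linearMap_ext (f := bdry ∘ₗ cone a) (g := LinearMap.id + cone a ∘ₗ bdry) (fun l => ?_) z
  simp [bdry_single, facetSum]

theorem bdry_bdry {E : Type*} (z : ModTwoChain E) : bdry (bdry z) = 0 := by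
  refine linearMap_ext (f := bdry ∘ₗ bdry) (g := 0) (fun l => ?_) z
  induction l with
  | nil => simp [bdry_single, facetSum]
  | cons a l ih =>
    simp only [LinearMap.comp_apply, LinearMap.zero_apply, bdry_single] at ih ⊢
    rw [facetSum, map_add, bdry_cone, ih, bdry_single, map_zero, add_zero, add_self]

theorem antipode_cone {E : Type*} [Neg E] (a : E) (z : ModTwoChain E) :
    antipode (cone a z) = cone (-a) (antipode z) := by
  refine comp_ext (fun l => ?_) z
  simp

theorem bdry_antipode {E : Type*} [Neg E] (z : ModTwoChain E) :
    bdry (antipode z) = antipode (bdry z) := by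
  refine comp_ext (fun l => ?_) z
  induction l with
  | nil => simp [bdry_single, facetSum]
  | cons a l ih =>
    simp only [bdry_single, antipode_single] at ih ⊢
    rw [List.map_cons, facetSum, facetSum, map_add, antipode_cone, ih, antipode_single]

theorem antipode_antipode {E : Type*} [InvolutiveNeg E] (z : ModTwoChain E) :
    antipode (antipode z) = z := by
  refine linearMap_ext (f := antipode ∘ₗ antipode) (g := LinearMap.id) (fun l => ?_) z
  simp

theorem facetSum_mem_supp {E : Type*} (l : List E) :
    facetSum l ∈ supp fun t => t.Sublist l ∧ t.length + 1 = l.length := by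
  induction l with
  | nil => simp [facetSum]
  | cons a l ih =>
    refine add_mem (single_mem_supp ⟨List.sublist_cons_self a l, by simp⟩) ?_
    refine induction_supp (cone a) _ (fun t ht => ?_) ih
    rw [cone_single]
    exact single_mem_supp ⟨ht.1.cons_cons a, by simp [ht.2]⟩

theorem bdry_mem_supp {E : Type*} {K : Set E} {z : ModTwoChain E}
    (hz : z ∈ supp fun l => ∀ x ∈ l, x ∈ K) : bdry z ∈ supp fun l => ∀ x ∈ l, x ∈ K := by
  refine induction_supp bdry _ (fun l hl => ?_) hz
  rw [bdry_single]
  exact supp_mono (fun t ht x hx => hl x (ht.1.subset hx)) (facetSum_mem_supp l)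

/-! ### Barycentric subdivision -/

/-- The barycenter of the vertices of a simplex. -/
noncomputable def barycenter {E : Type*} [AddCommGroup E] [Module ℝ E] (l : List E) : E :=
  (l.length : ℝ)⁻¹ • l.sum

/-- Barycentric subdivision of the simplices with `k` vertices. -/
noncomputable def subdiv {E : Type*} [AddCommGroup E] [Module ℝ E] :
    ℕ → ModTwoChain E →ₗ[ZMod 2] ModTwoChain E
  | 0 => LinearMap.id
  | k + 1 => linearCombination (ZMod 2) fun l => cone (barycenter l) (subdiv k (facetSum l))

theorem subdiv_succ_single {E : Type*} [AddCommGroup E] [Module ℝ E] (k : ℕ) (l : List E) :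
    subdiv (k + 1) (single l 1) = cone (barycenter l) (subdiv k (facetSum l)) := by
  simp [subdiv]

theorem bdry_subdiv {E : Type*} [AddCommGroup E] [Module ℝ E] (k : ℕ) (z : ModTwoChain E) :
    bdry (subdiv (k + 1) z) = subdiv k (bdry z) := by
  induction k generalizing z with
  | zero =>
    refine comp_ext (fun l => ?_) z
    rw [subdiv_succ_single, bdry_cone, ← bdry_single]
    simp [subdiv, bdry_bdry]
  | succ k ih =>
    refine comp_ext (fun l => ?_) z
    rw [subdiv_succ_single, bdry_cone, ← bdry_single, ih, bdry_bdry, map_zero, map_zero, add_zero]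

theorem barycenter_map_neg {E : Type*} [AddCommGroup E] [Module ℝ E] (l : List E) :
    barycenter (l.map Neg.neg) = -barycenter l := by
  have : (l.map Neg.neg).sum = -l.sum := by
    induction l with
    | nil => simp
    | cons a l ih => simp [ih, add_comm]
  simp [barycenter, this]

theorem subdiv_antipode {E : Type*} [AddCommGroup E] [Module ℝ E] (k : ℕ) (z : ModTwoChain E) :
    subdiv k (antipode z) = antipode (subdiv k z) := by
  induction k generalizing z with
  | zero => rfl
  | succ k ih =>
    refine comp_ext (fun l => ?_) z
    rw [antipode_single, subdiv_succ_single, subdiv_succ_single, antipode_cone, ← bdry_single,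
      ← bdry_single, ← antipode_single, bdry_antipode, ih, barycenter_map_neg]

theorem barycenter_mem {E : Type*} [AddCommGroup E] [Module ℝ E] {C : Set E} (hC : Convex ℝ C)
    {l : List E} (hl : l ≠ []) (h : ∀ x ∈ l, x ∈ C) : barycenter l ∈ C := by
  have hlen : (l.length : ℝ) ≠ 0 := by simpa using hl
  rw [barycenter, ← Fin.sum_univ_getElem l, Finset.smul_sum]
  refine hC.sum_mem (fun _ _ => by positivity) ?_ fun i _ => h _ (List.getElem_mem _)
  simp [hlen]

theorem dist_barycenter_le {E : Type*} [NormedAddCommGroup E] [NormedSpace ℝ E] {l : List E}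
    {r : ℝ} (h : ∀ x ∈ l, ∀ y ∈ l, dist x y ≤ r) {x : E} (hx : x ∈ l) :
    dist x (barycenter l) ≤ (1 - (l.length : ℝ)⁻¹) * r := by
  obtain ⟨i, hi, rfl⟩ := List.mem_iff_getElem.1 hx
  have hlen : (0 : ℝ) < l.length := by exact_mod_cast Nat.zero_lt_of_lt hi
  have hb : barycenter l - l[i] = (l.length : ℝ)⁻¹ • ∑ j : Fin l.length, (l[(j : ℕ)] - l[i]) := by
    rw [Finset.sum_sub_distrib, Fin.sum_univ_getElem, smul_sub, barycenter]
    simp only [Finset.sum_const, Finset.card_univ, Fintype.card_fin, ← Nat.cast_smul_eq_nsmul ℝ]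
    rw [inv_smul_smul₀ hlen.ne']
  have hsum : ∑ j : Fin l.length, ‖l[(j : ℕ)] - l[i]‖ ≤ (l.length - 1) * r := by
    rw [← Finset.add_sum_erase _ _ (Finset.mem_univ (⟨i, hi⟩ : Fin l.length))]
    refine (add_le_add_right (Finset.sum_le_card_nsmul _ _ r fun j _ => ?_) _).trans ?_
    · rw [← dist_eq_norm]
      exact h _ (List.getElem_mem _) _ (List.getElem_mem _)
    · simp [Finset.card_erase_of_mem, Nat.cast_sub (Nat.one_le_iff_ne_zero.2 (Nat.ne_zero_of_lt hi))]
  rw [dist_comm, dist_eq_norm, hb, norm_smul, norm_inv, Real.norm_natCast]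
  calc (l.length : ℝ)⁻¹ * ‖∑ j : Fin l.length, (l[(j : ℕ)] - l[i])‖
      ≤ (l.length : ℝ)⁻¹ * ((l.length - 1) * r) := by
        gcongr
        exact (norm_sum_le _ _).trans hsum
    _ = _ := by field_simp

/-- `l` has `k` vertices, all in `C`, at mutual distances at most `r`. -/
def IsSmall {E : Type*} [PseudoMetricSpace E] (C : Set E) (r : ℝ) (k : ℕ) (l : List E) : Prop :=
  l.length = k ∧ (∀ x ∈ l, x ∈ C) ∧ ∀ x ∈ l, ∀ y ∈ l, dist x y ≤ r

theorem subdiv_single_mem_supp {E : Type*} [NormedAddCommGroup E] [NormedSpace ℝ E] {N : ℕ}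
    {r : ℝ} (hr : 0 ≤ r) {k : ℕ} (hk : k ≤ N) {C : Set E} (hC : Convex ℝ C)
    {l : List E} (hl : IsSmall C r k l) :
    subdiv k (single l 1) ∈ supp (IsSmall C ((1 - (N : ℝ)⁻¹) * r) k) := by
  induction k generalizing C l with
  | zero =>
    obtain rfl := List.length_eq_zero_iff.1 hl.1
    exact single_mem_supp ⟨rfl, by simp, by simp⟩
  | succ k ih =>
    obtain ⟨hlen, hmem, hdist⟩ := hl
    have hl0 : l ≠ [] := by rintro rfl; simp at hlen
    set q : ℝ := (1 - (N : ℝ)⁻¹) * r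
    have hq : (1 - (l.length : ℝ)⁻¹) * r ≤ q := by
      rw [hlen]
      refine mul_le_mul_of_nonneg_right (sub_le_sub_left (inv_anti₀ (by positivity) ?_) 1) hr
      exact_mod_cast hk
    have hN : (N : ℝ)⁻¹ ≤ 1 := Nat.cast_inv_le_one N
    have hq0 : 0 ≤ q := mul_nonneg (by linarith) hr
    have hball : Convex ℝ (C ∩ Metric.closedBall (barycenter l) q) :=
      hC.inter (convex_closedBall _ _)
    have hb : barycenter l ∈ C := barycenter_mem hC hl0 hmem
    rw [subdiv_succ_single]
    have hsd : subdiv k (facetSum l) ∈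
        supp (IsSmall (C ∩ Metric.closedBall (barycenter l) q) q k) := by
      refine induction_supp (subdiv k) _ (fun t ht => ?_) (facetSum_mem_supp l)
      refine ih (by omega) hball ⟨by have := ht.2; omega, fun x hx => ?_, fun x hx y hy => ?_⟩
      · have hxl := ht.1.subset hx
        exact ⟨hmem x hxl, (dist_barycenter_le hdist hxl).trans hq⟩
      · exact hdist x (ht.1.subset hx) y (ht.1.subset hy)
    refine induction_supp (cone _) _ (fun t ht => ?_) hsd
    obtain ⟨htlen, htmem, htdist⟩ := ht
    rw [cone_single]
    refine single_mem_supp ⟨by simp [htlen], ?_, ?_⟩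
    · simpa using ⟨hb, fun x hx => (htmem x hx).1⟩
    · simp only [List.mem_cons, forall_eq_or_imp, dist_self]
      refine ⟨⟨hq0, fun x hx => ?_⟩, fun x hx => ⟨(htmem x hx).2, htdist x hx⟩⟩
      rw [dist_comm]
      exact (htmem x hx).2

/-! ### The sign-change cocycle -/

/-- Multiply a cochain by the value of `s` at the first vertex. -/
noncomputable def headMul {E : Type*} (s : E → ZMod 2) (β : ModTwoChain E →ₗ[ZMod 2] ZMod 2) :
    ModTwoChain E →ₗ[ZMod 2] ZMod 2 :=
  linearCombination (ZMod 2) fun l : List E =>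
    match l with
    | [] => 0
    | a :: t => s a * β (single (a :: t) 1)

/-- The cocycle counting simplices along whose successive edges the signs `s i` change. -/
noncomputable def signCocycle {E : Type*} (s : ℕ → E → ZMod 2) :
    ℕ → ModTwoChain E →ₗ[ZMod 2] ZMod 2
  | 0 => lapply [] ∘ₗ bdry
  | j + 1 => headMul (s j) (signCocycle s j) ∘ₗ bdry

theorem signCocycle_bdry {E : Type*} (s : ℕ → E → ZMod 2) (j : ℕ) (z : ModTwoChain E) :
    signCocycle s j (bdry z) = 0 := by
  cases j <;> simp [signCocycle, bdry_bdry]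

theorem signCocycle_single_nil {E : Type*} (s : ℕ → E → ZMod 2) (j : ℕ) :
    signCocycle s j (single [] 1) = 0 := by
  cases j <;> simp [signCocycle, bdry_single, facetSum]

theorem headMul_cone {E : Type*} (s : E → ZMod 2) (β : ModTwoChain E →ₗ[ZMod 2] ZMod 2) (a : E)
    (z : ModTwoChain E) : headMul s β (cone a z) = s a * β (cone a z) := by
  refine linearMap_ext (f := headMul s β ∘ₗ cone a) (g := s a • (β ∘ₗ cone a)) (fun l => ?_) z
  simp [headMul]

theorem signCocycle_succ_cons_cons {E : Type*} (s : ℕ → E → ZMod 2) (j : ℕ) (a b : E)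
    (l : List E) : signCocycle s (j + 1) (single (a :: b :: l) 1) =
      (s j a + s j b) * signCocycle s j (single (b :: l) 1) := by
  have h := signCocycle_bdry s j (single (a :: b :: l) 1)
  rw [bdry_single, facetSum, map_add, CharTwo.add_eq_zero] at h
  rw [signCocycle, LinearMap.comp_apply, bdry_single, facetSum, map_add, headMul_cone, ← h]
  simp only [headMul, linearCombination_single, one_smul]
  ring

theorem exists_ne_of_signCocycle_ne_zero {E : Type*} (s : ℕ → E → ZMod 2) (j : ℕ) (l : List E)
    (h : signCocycle s j (single l 1) ≠ 0) : ∀ i < j, ∃ a ∈ l, ∃ b ∈ l, s i a ≠ s i b := by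
  induction j generalizing l with
  | zero => simp
  | succ j ih =>
    match l with
    | [] => exact absurd (signCocycle_single_nil s _) h
    | [a] =>
      refine absurd ?_ h
      simp [signCocycle, bdry_single, facetSum, headMul]
    | a :: b :: l =>
      rw [signCocycle_succ_cons_cons] at h
      intro i hi
      rcases Nat.lt_succ_iff_lt_or_eq.1 hi with hi | rfl
      · obtain ⟨x, hx, y, hy, hxy⟩ := ih _ (right_ne_zero_of_mul h) i hi
        exact ⟨x, List.mem_cons_of_mem _ hx, y, List.mem_cons_of_mem _ hy, hxy⟩
      · refine ⟨a, by simp, b, by simp, fun hab => left_ne_zero_of_mul h ?_⟩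
        rw [hab, CharTwo.add_self_eq_zero]

theorem signCocycle_antipode {E : Type*} [Neg E] {K : Set E} {s : ℕ → E → ZMod 2}
    {m : ℕ} (hs : ∀ i < m, ∀ x ∈ K, s i (-x) = s i x + 1) {j : ℕ} (hj : j ≤ m) :
    (∀ z ∈ supp fun l => ∀ x ∈ l, x ∈ K, signCocycle s j (antipode z) = signCocycle s j z) ∧
    (j < m → ∀ z ∈ supp fun l => ∀ x ∈ l, x ∈ K,
      headMul (s j) (signCocycle s j) (z + antipode z) = signCocycle s j z) := by
  have key : ∀ j < m,
      (∀ z ∈ supp fun l => ∀ x ∈ l, x ∈ K, signCocycle s j (antipode z) = signCocycle s j z) →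
      ∀ z ∈ supp fun l => ∀ x ∈ l, x ∈ K,
        headMul (s j) (signCocycle s j) (z + antipode z) = signCocycle s j z := by
    intro j hj hinv z hz
    refine sub_eq_zero.1 (eq_zero_of_mem_supp (headMul (s j) (signCocycle s j) ∘ₗ
      (LinearMap.id + antipode) - signCocycle s j) (fun l hl => ?_) hz)
    have hl' := hinv _ (single_mem_supp hl)
    rw [antipode_single] at hl'
    cases l with
    | nil => simp [headMul, signCocycle_single_nil]
    | cons a l =>
      have ha := hs j hj a (hl a (by simp))
      simp only [List.map_cons] at hl'
      simp only [headMul, LinearMap.sub_apply, LinearMap.comp_apply, LinearMap.add_apply,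
        LinearMap.id_apply, antipode_single, List.map_cons, map_add, linearCombination_single,
        one_smul, hl', ha]
      linear_combination CharTwo.add_self_eq_zero
        (s j a * signCocycle s j (single (a :: l) 1))
  have inv : ∀ j ≤ m, ∀ z ∈ supp fun l => ∀ x ∈ l, x ∈ K,
      signCocycle s j (antipode z) = signCocycle s j z := by
    intro j
    induction j with
    | zero =>
      intro _ z _
      have h : ∀ z : ModTwoChain E, (antipode z) [] = z [] := fun z => by
        refine linearMap_ext (f := lapply [] ∘ₗ antipode) (g := lapply []) (fun l => ?_) z
        cases l <;> simp
      simp [signCocycle, bdry_antipode, h]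
    | succ j ih =>
      intro hj z hz
      have h := key j (by omega) (ih (by omega)) _ (bdry_mem_supp hz)
      rw [signCocycle_bdry, map_add, CharTwo.add_eq_zero] at h
      simp [signCocycle, bdry_antipode, h]
  exact ⟨inv j hj, fun h => key j h (inv j hj)⟩

/-- A sequence of hemispheres: each one bounds the union of the previous one and its antipode. -/
def IsHemisphereSeq {E : Type*} [Neg E] (c : ℕ → ModTwoChain E) : Prop :=
  bdry (c 0) = single [] 1 ∧ ∀ j, bdry (c (j + 1)) = c j + antipode (c j)

theorem IsHemisphereSeq.signCocycle_eq_one {E : Type*} [Neg E] {c : ℕ → ModTwoChain E}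
    (hc : IsHemisphereSeq c) {K : Set E} {s : ℕ → E → ZMod 2} {m : ℕ}
    (hs : ∀ i < m, ∀ x ∈ K, s i (-x) = s i x + 1)
    (hK : ∀ j ≤ m, c j ∈ supp fun l => ∀ x ∈ l, x ∈ K) {j : ℕ} (hj : j ≤ m) :
    signCocycle s j (c j) = 1 := by
  induction j with
  | zero => simp [signCocycle, hc.1]
  | succ j ih =>
    rw [signCocycle, LinearMap.comp_apply, hc.2,
      (signCocycle_antipode hs (by omega)).2 (by omega) _ (hK j (by omega)), ih (by omega)]

theorem IsHemisphereSeq.subdiv {E : Type*} [AddCommGroup E] [Module ℝ E]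
    {c : ℕ → ModTwoChain E} (hc : IsHemisphereSeq c) :
    IsHemisphereSeq fun j => ModTwoChain.subdiv (j + 1) (c j) := by
  refine ⟨?_, fun j => ?_⟩
  · simp only [bdry_subdiv, hc.1]
    rfl
  · simp only [bdry_subdiv, hc.2, map_add, subdiv_antipode]

/-! ### The octahedral sphere -/

/-- The facet of the octahedral sphere with sign pattern `σ`. -/
def octFacet {n : ℕ} (σ : Fin n → ℝ) : Set (Fin n → ℝ) :=
  {x | (∀ i, 0 ≤ σ i * x i) ∧ ∑ i, σ i * x i = 1}

theorem convex_octFacet {n : ℕ} (σ : Fin n → ℝ) : Convex ℝ (octFacet σ) := by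
  intro x hx y hy a b ha hb hab
  refine ⟨fun i => ?_, ?_⟩
  · have := add_nonneg (mul_nonneg ha (hx.1 i)) (mul_nonneg hb (hy.1 i))
    simp only [Pi.add_apply, Pi.smul_apply, smul_eq_mul]
    linarith
  · have : ∑ i, σ i * (a • x + b • y) i = a * ∑ i, σ i * x i + b * ∑ i, σ i * y i := by
      simp only [Finset.mul_sum, ← Finset.sum_add_distrib]
      refine Finset.sum_congr rfl fun i _ => ?_
      simp only [Pi.add_apply, Pi.smul_apply, smul_eq_mul]
      ring
    rw [this, hx.2, hy.2]
    linarith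

theorem sum_abs_of_mem_octFacet {n : ℕ} {σ : Fin n → ℝ} (hσ : ∀ i, |σ i| = 1) {x : Fin n → ℝ}
    (hx : x ∈ octFacet σ) : ∑ i, |x i| = 1 := by
  rw [← hx.2]
  refine Finset.sum_congr rfl fun i _ => ?_
  rw [← abs_of_nonneg (hx.1 i), abs_mul, hσ, one_mul]

theorem norm_le_one_of_sum_abs {n : ℕ} {x : Fin n → ℝ} (hx : ∑ i, |x i| = 1) : ‖x‖ ≤ 1 := by
  rw [pi_norm_le_iff_of_nonneg zero_le_one]
  intro i
  rw [← hx, Real.norm_eq_abs]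
  exact Finset.single_le_sum (f := fun i => |x i|) (fun _ _ => abs_nonneg _) (Finset.mem_univ i)

/-- The standard hemispheres of the octahedral sphere, built as iterated cones. -/
noncomputable def octHemisphere {E : Type*} [Neg E] (e : ℕ → E) : ℕ → ModTwoChain E
  | 0 => single [e 0] 1
  | j + 1 => cone (e (j + 1)) (octHemisphere e j + antipode (octHemisphere e j))

theorem isHemisphereSeq_octHemisphere {E : Type*} [InvolutiveNeg E] (e : ℕ → E) :
    IsHemisphereSeq (octHemisphere e) := by
  have h : ∀ j, bdry (octHemisphere e j + antipode (octHemisphere e j)) = 0 := by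
    intro j
    induction j with
    | zero => simp [octHemisphere, bdry_single, facetSum, add_self]
    | succ j ih =>
      rw [map_add, bdry_antipode, octHemisphere, bdry_cone, ih, map_zero, add_zero, map_add,
        antipode_antipode, add_comm (antipode _), add_self]
  refine ⟨by simp [octHemisphere, bdry_single, facetSum], fun j => ?_⟩
  rw [octHemisphere, bdry_cone, h, map_zero, add_zero]

/-- Every simplex of a hemisphere is contained in a facet, and its vertices vanish in the
coordinates not used yet. -/
theorem octHemisphere_mem_supp {n : ℕ} {e : ℕ → Fin n → ℝ}
    (he : ∀ j (hj : j < n), e j = Pi.single ⟨j, hj⟩ 1) {j : ℕ} (hj : j < n) :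
    octHemisphere e j ∈ supp fun l => l.length = j + 1 ∧ ∃ σ : Fin n → ℝ, (∀ i, |σ i| = 1) ∧
      ∀ x ∈ l, x ∈ octFacet σ ∧ ∀ i : Fin n, j < i → x i = 0 := by
  induction j with
  | zero =>
    refine single_mem_supp ⟨rfl, fun _ => 1, by simp, ?_⟩
    simp only [List.mem_singleton, forall_eq, he 0 hj]
    refine ⟨⟨fun i => ?_, by simp⟩, fun i hi => Pi.single_eq_of_ne ?_ _⟩
    · by_cases h : i = ⟨0, hj⟩
      · subst h; simp
      · simp [h]
    · rintro rfl
      simp at hi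
  | succ j ih =>
    have hc := ih (by omega)
    refine induction_supp (cone _) _ (fun l hl => ?_) (add_mem hc
      (induction_supp antipode _ (fun l hl => ?_) hc))
    · obtain ⟨hlen, σ, hσ, hmem⟩ := hl
      rw [cone_single]
      have hmem' : ∀ x ∈ l, x ∈ octFacet (Function.update σ ⟨j + 1, hj⟩ 1) := by
        intro x hx
        obtain ⟨⟨hpos, hsum⟩, hzero⟩ := hmem x hx
        have heq : ∀ i, Function.update σ ⟨j + 1, hj⟩ 1 i * x i = σ i * x i := by
          intro i
          by_cases h : i = ⟨j + 1, hj⟩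
          · subst h
            rw [hzero _ (by simp), mul_zero, mul_zero]
          · rw [Function.update_of_ne h]
        simp only [octFacet, Set.mem_ofPred_eq, heq]
        exact ⟨hpos, hsum⟩
      refine single_mem_supp ⟨by simp [hlen], Function.update σ ⟨j + 1, hj⟩ 1, fun i => ?_, ?_⟩
      · by_cases h : i = ⟨j + 1, hj⟩
        · subst h; simp
        · rw [Function.update_of_ne h, hσ]
      · intro x hx
        rcases List.mem_cons.1 hx with rfl | hx
        · rw [he _ hj]
          refine ⟨⟨fun i => ?_, by simp [Pi.single_apply]⟩, fun i hi => Pi.single_eq_of_ne ?_ _⟩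
          · by_cases h : i = ⟨j + 1, hj⟩
            · subst h; simp
            · simp [h]
          · rintro rfl
            simp at hi
        · exact ⟨hmem' x hx, fun i hi => (hmem x hx).2 i (by omega)⟩
    · obtain ⟨hlen, σ, hσ, hmem⟩ := hl
      rw [antipode_single]
      refine single_mem_supp ⟨by simp [hlen], -σ, by simpa using hσ, ?_⟩
      simp only [List.mem_map, forall_exists_index, and_imp, forall_apply_eq_imp_iff₂]
      intro x hx
      obtain ⟨⟨hpos, hsum⟩, hzero⟩ := hmem x hx
      exact ⟨⟨by simpa using hpos, by simpa using hsum⟩, by simpa using hzero⟩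

/-- `l` is a small simplex with `k` vertices inside some facet of the octahedral sphere. -/
def IsSmallOct {n : ℕ} (r : ℝ) (k : ℕ) (l : List (Fin n → ℝ)) : Prop :=
  ∃ σ : Fin n → ℝ, (∀ i, |σ i| = 1) ∧ IsSmall (octFacet σ) r k l

theorem exists_isHemisphereSeq (n : ℕ) (t : ℕ) : ∃ c : ℕ → ModTwoChain (Fin n → ℝ),
    IsHemisphereSeq c ∧ ∀ j < n, c j ∈ supp (IsSmallOct ((1 - (n : ℝ)⁻¹) ^ t * 2) (j + 1)) := by
  induction t with
  | zero =>
    let e : ℕ → Fin n → ℝ := fun j => if hj : j < n then Pi.single ⟨j, hj⟩ 1 else 0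
    refine ⟨octHemisphere e, isHemisphereSeq_octHemisphere e, fun j hj => ?_⟩
    refine supp_mono (fun l hl => ?_) (octHemisphere_mem_supp (e := e)
      (fun j hj => by simp [e, hj]) hj)
    obtain ⟨hlen, σ, hσ, hmem⟩ := hl
    refine ⟨σ, hσ, hlen, fun x hx => (hmem x hx).1, fun x hx y hy => ?_⟩
    have hnorm : ∀ x ∈ l, ‖x‖ ≤ 1 := fun x hx =>
      norm_le_one_of_sum_abs (sum_abs_of_mem_octFacet hσ (hmem x hx).1)
    rw [pow_zero, one_mul, dist_eq_norm]
    linarith [norm_sub_le x y, hnorm x hx, hnorm y hy]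
  | succ t ih =>
    obtain ⟨c, hc, hsupp⟩ := ih
    refine ⟨_, hc.subdiv, fun j hj => ?_⟩
    refine induction_supp (ModTwoChain.subdiv (j + 1)) _ (fun l hl => ?_) (hsupp j hj)
    obtain ⟨σ, hσ, hl⟩ := hl
    have hn : 0 ≤ 1 - (n : ℝ)⁻¹ := sub_nonneg.2 (Nat.cast_inv_le_one n)
    have h := subdiv_single_mem_supp (N := n) (by positivity) hj (convex_octFacet σ) hl
    rw [← mul_assoc, ← pow_succ'] at h
    exact supp_mono (fun l hl => ⟨σ, hσ, hl⟩) h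

end ModTwoChain

open ModTwoChain in
/-- The Borsuk-Ulam theorem on the octahedral sphere. -/
theorem exists_eq_zero_of_odd_octahedral {m : ℕ} {h : (Fin (m + 1) → ℝ) → Fin m → ℝ}
    (hcont : ContinuousOn h {x | ∑ i, |x i| = 1})
    (hodd : ∀ x, ∑ i, |x i| = 1 → h (-x) = -h x) : ∃ x, ∑ i, |x i| = 1 ∧ h x = 0 := by
  set K : Set (Fin (m + 1) → ℝ) := {x | ∑ i, |x i| = 1} with hKdef
  have hclosed : IsClosed K := isClosed_eq (by fun_prop) continuous_const
  have hK : IsCompact K := (isCompact_closedBall (0 : Fin (m + 1) → ℝ) 1).of_isClosed_subset hclosed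
    fun x hx => mem_closedBall_zero_iff.2 (norm_le_one_of_sum_abs hx)
  by_contra! hne
  have hKne : K.Nonempty := ⟨Pi.single 0 1, by simp [hKdef, Pi.single_apply, apply_ite abs]⟩
  obtain ⟨x₀, hx₀, hmin⟩ := hK.exists_isMinOn hKne hcont.norm
  have hpos : 0 < ‖h x₀‖ := norm_pos_iff.2 (hne x₀ hx₀)
  obtain ⟨δ, hδ, hunif⟩ := Metric.uniformContinuousOn_iff.1
    (hK.uniformContinuousOn_of_continuous hcont) (‖h x₀‖ / 2) (by positivity)
  obtain ⟨t, ht⟩ : ∃ t : ℕ, (1 - ((m + 1 : ℕ) : ℝ)⁻¹) ^ t * 2 < δ := by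
    obtain ⟨t, ht⟩ := exists_pow_lt_of_lt_one (half_pos hδ)
      (sub_lt_self (1 : ℝ) (by positivity : (0 : ℝ) < ((m + 1 : ℕ) : ℝ)⁻¹))
    exact ⟨t, by linarith⟩
  obtain ⟨c, hc, hsupp⟩ := exists_isHemisphereSeq (m + 1) t
  -- break ties in the sign of `h x i` by an arbitrary choice between `x` and `-x`
  classical
  let s : ℕ → (Fin (m + 1) → ℝ) → ZMod 2 := fun i x =>
    if hi : i < m then
      if 0 < h x ⟨i, hi⟩ then 1 else if h x ⟨i, hi⟩ < 0 then 0
      else if WellOrderingRel x (-x) then 1 else 0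
    else 0
  have hs : ∀ i < m, ∀ x ∈ K, s i (-x) = s i x + 1 := by
    intro i hi x hx
    have h2 : (1 : ZMod 2) + 1 = 0 := CharTwo.add_self_eq_zero 1
    have hxne : x ≠ -x := by
      intro hx'
      obtain rfl : x = 0 := self_eq_neg.1 hx'
      simp [hKdef] at hx
    simp only [s, hi, dif_pos, hodd x hx, Pi.neg_apply, Left.neg_pos_iff, Left.neg_neg_iff,
      neg_neg]
    rcases lt_trichotomy (h x ⟨i, hi⟩) 0 with hlt | heq | hgt
    · simp [hlt, hlt.not_gt]
    · simp only [heq, lt_irrefl, if_false]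
      rcases trichotomous_of WellOrderingRel x (-x) with hlt | heq | hgt
      · simp [hlt, asymm_of WellOrderingRel hlt, h2]
      · exact absurd heq hxne
      · simp [hgt, asymm_of WellOrderingRel hgt]
    · simp [hgt, hgt.not_gt, h2]
  have hone := hc.signCocycle_eq_one hs (fun j hj => supp_mono (fun l hl x hx => by
    obtain ⟨σ, hσ, hl⟩ := hl
    exact sum_abs_of_mem_octFacet hσ (hl.2.1 x hx)) (hsupp j (by omega))) le_rfl
  obtain ⟨l, ⟨σ, hσ, hlen, hmem, hdist⟩, hl⟩ : ∃ l,
      IsSmallOct ((1 - ((m + 1 : ℕ) : ℝ)⁻¹) ^ t * 2) (m + 1) l ∧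
      signCocycle s m (single l 1) ≠ 0 := by
    by_contra! hcon
    exact one_ne_zero (hone.symm.trans (eq_zero_of_mem_supp _ hcon (hsupp m (by omega))))
  have hlK : ∀ x ∈ l, x ∈ K := fun x hx => sum_abs_of_mem_octFacet hσ (hmem x hx)
  have hclose : ∀ x ∈ l, ∀ y ∈ l, ∀ i, |h x i - h y i| < ‖h x₀‖ / 2 := by
    intro x hx y hy i
    have h1 := hunif x (hlK x hx) y (hlK y hy) ((hdist x hx y hy).trans_lt ht)
    rw [dist_eq_norm] at h1
    exact (norm_le_pi_norm (h x - h y) i).trans_lt h1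
  obtain ⟨v, hv⟩ := List.exists_mem_of_length_pos (by omega : 0 < l.length)
  have hsmall : ‖h v‖ < ‖h x₀‖ := by
    rw [pi_norm_lt_iff hpos]
    intro i
    obtain ⟨a, ha, b, hb, hab⟩ := exists_ne_of_signCocycle_ne_zero s m l hl i i.2
    have hva := abs_lt.1 (hclose v hv a ha i)
    have hvb := abs_lt.1 (hclose v hv b hb i)
    simp only [s, i.2, dif_pos, Fin.eta] at hab
    rw [Real.norm_eq_abs, abs_lt]
    have hcl := abs_lt.1 (hclose a ha b hb i)
    by_cases hap : 0 < h a i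
    · by_cases hbp : 0 < h b i
      · simp [hap, hbp] at hab
      · constructor <;> linarith
    · by_cases han : h a i < 0
      · by_cases hbn : h b i < 0
        · simp [hap, han, hbn, hbn.not_gt] at hab
        · constructor <;> linarith
      · constructor <;> linarith
  exact (hmin (hlK v hv)).not_gt hsmall

/-- A continuous map one of whose components has a topologically critical point of index
`k` is not injective; hence it cannot be the (injective) time-T map of a basic or
augmented neural ODE. -/
theorem stmt_19 (n : ℕ) (hn : 1 ≤ n) (X : Set (Fin n → ℝ)) (hX : IsOpen X)
    (Φ : (Fin n → ℝ) → (Fin n → ℝ)) (hΦ : ContinuousOn Φ X)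
    (i : Fin n) (p : Fin n → ℝ) (hp : p ∈ X) (k : ℕ) (hk : k ≤ n)
    (U : Set (Fin n → ℝ)) (hU : U ∈ nhds (0 : Fin n → ℝ))
    (μ : (Fin n → ℝ) → (Fin n → ℝ))
    (hμ0 : μ 0 = p) (hμX : μ '' U ⊆ X)
    (hμc : ContinuousOn μ U) (hμinj : Set.InjOn μ U)
    (hμinv : ∃ ν : (Fin n → ℝ) → (Fin n → ℝ),
      ContinuousOn ν (μ '' U) ∧ ∀ u ∈ U, ν (μ u) = u)
    (hmorse : ∀ u ∈ U, Φ (μ u) i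
      = Φ p i + ∑ j : Fin n, (if (j : ℕ) < k then (-1 : ℝ) else 1) * (u j) ^ 2) :
    ¬ Set.InjOn Φ X := by
  intro hinj
  obtain ⟨m, rfl⟩ : ∃ m, n = m + 1 := ⟨n - 1, by omega⟩
  obtain ⟨ρ, hρ, hball⟩ := Metric.nhds_basis_closedBall.mem_iff.1 hU
  have hmemU : ∀ x : Fin (m + 1) → ℝ, ∑ i, |x i| = 1 → ρ • x ∈ U := fun x hx => by
    refine hball (mem_closedBall_zero_iff.2 ?_)
    rw [norm_smul, Real.norm_of_nonneg hρ.le]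
    exact mul_le_of_le_one_right hρ.le (ModTwoChain.norm_le_one_of_sum_abs hx)
  have hneg : ∀ x : Fin (m + 1) → ℝ, ∑ i, |x i| = 1 → ∑ i, |(-x) i| = 1 := fun x hx => by
    simpa using hx
  have hcomp : ContinuousOn (fun u => Φ (μ u)) U := hΦ.comp hμc (Set.mapsTo_iff_image_subset.2 hμX)
  have hpos : ContinuousOn (fun x => Φ (μ (ρ • x))) {x : Fin (m + 1) → ℝ | ∑ i, |x i| = 1} :=
    hcomp.comp (f := fun x => ρ • x) (by fun_prop) hmemU
  have hpos' : ContinuousOn (fun x => Φ (μ (ρ • -x))) {x : Fin (m + 1) → ℝ | ∑ i, |x i| = 1} :=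
    hpos.comp (f := fun x => -x) (by fun_prop) hneg
  obtain ⟨x, hx, hx0⟩ := exists_eq_zero_of_odd_octahedral
    (h := fun x j => Φ (μ (ρ • x)) (i.succAbove j) - Φ (μ (ρ • -x)) (i.succAbove j))
    (continuousOn_pi.2 fun j => (continuousOn_pi.1 hpos _).sub (continuousOn_pi.1 hpos' _))
    (fun x _ => by ext j; simp)
  have hU₁ := hmemU x hx
  have hU₂ := hmemU (-x) (hneg x hx)
  have hΦeq : Φ (μ (ρ • x)) = Φ (μ (ρ • -x)) := by
    ext j
    rcases Fin.eq_self_or_eq_succAbove i j with rfl | ⟨j, rfl⟩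
    · rw [hmorse _ hU₁, hmorse _ hU₂]
      simp
    · exact sub_eq_zero.1 (congrFun hx0 j)
  have hxeq := hμinj hU₁ hU₂
    (hinj (hμX (Set.mem_image_of_mem _ hU₁)) (hμX (Set.mem_image_of_mem _ hU₂)) hΦeq)
  obtain rfl : x = 0 := self_eq_neg.1 (smul_right_injective _ hρ.ne' hxeq)
  simp at hx
end
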